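/- arXiv:1003.0267 — 2 statements merged into one kernel-verified Lean document; each statement's English description precedes it below -/
import Mathlib

section
/- Let d ≥ 2, R̄ = ℂ[x]/(x^d), r = z^k + t^l + x with k,l ≥ 2 coprime, and 1 ≤ j ≤ d-1. Let Ā_j(r) be the group of special R̄-automorphisms φ of R̄[z,t] with φ ≡ id mod (x^j) and φ(r) ∈ (r). Then the map Ψ_j : Ā_j(r) → ℂ[z,t] sending φ to the element α with Φ_j(φ) ≡ α·r₀ mod constants (where r₀ = z^k+t^l and Φ_j(φ) is determined by φ(z) ≡ z + x^j·(Φ_jφ)_t, φ(t) ≡ t - x^j·(Φ_jφ)_z mod x^{j+1}) is a surjective group homomorphism with kernel Ā_{j+1}(r); hence Ā_j(r)/Ā_{j+1}(r) ≅ (ℂ[z,t], +). -/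
open MvPolynomial

/-- The Poisson bracket / Jacobian pairing on `ℂ[x,z,t]` with respect to `z`
(index 1) and `t` (index 2). -/
noncomputable def pb (f g : MvPolynomial (Fin 3) ℂ) : MvPolynomial (Fin 3) ℂ :=
  pderiv 1 f * pderiv 2 g - pderiv 2 f * pderiv 1 g

/-- The ideal `(x^d)` of `ℂ[x,z,t]`. -/
noncomputable def Idl (d : ℕ) : Ideal (MvPolynomial (Fin 3) ℂ) :=
  Ideal.span {(X 0 : MvPolynomial (Fin 3) ℂ) ^ d}

/-- `R̄[z,t] = (ℂ[x]/(x^d))[z,t] = ℂ[x,z,t]/(x^d)`. -/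
abbrev Qr (d : ℕ) := MvPolynomial (Fin 3) ℂ ⧸ Idl d

/-- The quotient map `ℂ[x,z,t] → R̄[z,t]`. -/
noncomputable def qk (d : ℕ) : MvPolynomial (Fin 3) ℂ →ₐ[ℂ] Qr d :=
  Ideal.Quotient.mkₐ ℂ (Idl d)

/-- Membership in `Ā_j` : `φ` is an `R̄`-automorphism of `R̄[z,t]` (it fixes
`x`), it is special (its Jacobian determinant is a nonzero constant), and
`φ ≡ id mod (x^j)`. -/
def MemA (d j : ℕ) (φ : Qr d ≃ₐ[ℂ] Qr d) : Prop :=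
  φ (qk d (X 0)) = qk d (X 0) ∧
  ∃ p q : MvPolynomial (Fin 3) ℂ,
    φ (qk d (X 1)) = qk d p ∧ φ (qk d (X 2)) = qk d q ∧
    (∃ c : ℂ, c ≠ 0 ∧ pb p q - C c ∈ Idl d) ∧
    p - X 1 ∈ Ideal.span {(X 0 : MvPolynomial (Fin 3) ℂ) ^ j} ∧
    q - X 2 ∈ Ideal.span {(X 0 : MvPolynomial (Fin 3) ℂ) ^ j}

/-- `Φ_j(φ) = h` : `h ∈ (z,t) ⊂ ℂ[z,t]` and `φ(z) ≡ z + h_t·x^j`,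
`φ(t) ≡ t - h_z·x^j` modulo `(x^{j+1})`. -/
def RelPhi (d j : ℕ) (φ : Qr d ≃ₐ[ℂ] Qr d) (h : MvPolynomial (Fin 3) ℂ) : Prop :=
  pderiv 0 h = 0 ∧ constantCoeff h = 0 ∧
  ∃ p q : MvPolynomial (Fin 3) ℂ,
    φ (qk d (X 1)) = qk d p ∧ φ (qk d (X 2)) = qk d q ∧
    p - (X 1 + pderiv 2 h * X 0 ^ j) ∈
      Ideal.span {(X 0 : MvPolynomial (Fin 3) ℂ) ^ (j + 1)} ∧
    q - (X 2 - pderiv 1 h * X 0 ^ j) ∈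
      Ideal.span {(X 0 : MvPolynomial (Fin 3) ℂ) ^ (j + 1)}


/-- Membership in `Ā_j(r)` : `φ ∈ Ā_j` and `φ` preserves the ideal `(r)` of
`R̄[z,t]`. -/
def MemAr (d j : ℕ) (r : MvPolynomial (Fin 3) ℂ) (φ : Qr d ≃ₐ[ℂ] Qr d) : Prop :=
  MemA d j φ ∧ φ (qk d r) ∈ Ideal.span {qk d r}

/-- `Ψ_j(φ) = α` : the Hamiltonian `Φ_j(φ)` equals `α·r₀` up to an additive
constant, where `α ∈ ℂ[z,t]`. -/
def RelPsi (d j : ℕ) (r₀ : MvPolynomial (Fin 3) ℂ) (φ : Qr d ≃ₐ[ℂ] Qr d)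
    (α : MvPolynomial (Fin 3) ℂ) : Prop :=
  pderiv 0 α = 0 ∧
  ∃ (h : MvPolynomial (Fin 3) ℂ) (c : ℂ),
    RelPhi d j φ h ∧ h - α * r₀ = C c


abbrev PP := MvPolynomial (Fin 3) ℂ

lemma pd_comm (i j : Fin 3) (f : PP) : pderiv i (pderiv j f) = pderiv j (pderiv i f) := by
  have h : ⁅(pderiv i : Derivation ℂ PP PP), (pderiv j : Derivation ℂ PP PP)⁆ = 0 := by
    apply MvPolynomial.derivation_ext
    intro m
    rw [Derivation.commutator_apply, pderiv_X, pderiv_X]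
    simp only [Pi.single_apply]
    split_ifs <;> simp
  have h2 := DFunLike.congr_fun h f
  rw [Derivation.commutator_apply] at h2
  exact sub_eq_zero.mp h2

noncomputable def Eu (a b c : ℕ) (f : PP) : PP :=
  a • (X 0 * pderiv 0 f) + b • (X 1 * pderiv 1 f) + c • (X 2 * pderiv 2 f)

lemma coeff_Eu (a b c : ℕ) (f : PP) (s : Fin 3 →₀ ℕ) :
    coeff s (Eu a b c f) = ((a * s 0 + b * s 1 + c * s 2 : ℕ) : ℂ) * coeff s f := by
  induction f using MvPolynomial.induction_on' with
  | monomial u r =>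
    simp only [Eu, X_mul_pderiv_monomial, coeff_add, coeff_smul, coeff_monomial]
    by_cases h : u = s
    · subst h
      simp
      ring
    · simp [h]
  | add p q hp hq =>
    have : Eu a b c (p + q) = Eu a b c p + Eu a b c q := by
      simp only [Eu, map_add, mul_add, smul_add]; ring
    rw [this, coeff_add, coeff_add, hp, hq]; ring

lemma Eu_solve (a b c n : ℕ) (g : PP)
    (h : ∀ s : Fin 3 →₀ ℕ, a * s 0 + b * s 1 + c * s 2 + n = 0 → coeff s g = 0) :
    ∃ f, Eu a b c f + n • f = g := by
  refine ⟨∑ s ∈ g.support, monomial s (coeff s g / ((a * s 0 + b * s 1 + c * s 2 + n : ℕ) : ℂ)), ?_⟩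
  ext s
  rw [coeff_add, coeff_Eu, coeff_smul, coeff_sum]
  simp only [coeff_monomial, Finset.sum_ite_eq', nsmul_eq_mul]
  by_cases hs : s ∈ g.support
  · rw [if_pos hs, ← add_mul, ← Nat.cast_add]
    have h1 : ((a * s 0 + b * s 1 + c * s 2 + n : ℕ) : ℂ) ≠ 0 := by
      intro h0
      exact (mem_support_iff.mp hs) (h s (by exact_mod_cast h0))
    field_simp
  · rw [if_neg hs, notMem_support_iff.mp hs]; simp

lemma Eu_inj (a b c n : ℕ) (hn : 0 < n) (f : PP) (h : Eu a b c f + n • f = 0) : f = 0 := by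
  ext s
  have h1 := congrArg (coeff s) h
  rw [coeff_add, coeff_Eu, coeff_smul, nsmul_eq_mul, ← add_mul, ← Nat.cast_add, coeff_zero] at h1
  rcases mul_eq_zero.mp h1 with h2 | h2
  · exfalso
    have : a * s 0 + b * s 1 + c * s 2 + n = 0 := by exact_mod_cast h2
    omega
  · simpa using h2

lemma Eu_const (a b c : ℕ) (ha : 0 < a) (hb : 0 < b) (hc : 0 < c) (f : PP)
    (h0 : constantCoeff f = 0) (h : Eu a b c f = 0) : f = 0 := by
  ext s
  have h1 := congrArg (coeff s) h
  rw [coeff_Eu, coeff_zero] at h1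
  rcases mul_eq_zero.mp h1 with h2 | h2
  · have h3 : a * s 0 + b * s 1 + c * s 2 = 0 := by exact_mod_cast h2
    have h4 : s = 0 := by
      ext i
      have e0 : a * s 0 = 0 := by omega
      have e1 : b * s 1 = 0 := by omega
      have e2 : c * s 2 = 0 := by omega
      simp [ha.ne', hb.ne', hc.ne'] at e0 e1 e2
      fin_cases i <;> simpa
    subst h4
    simpa [constantCoeff_eq] using h0
  · simpa using h2

lemma X0_dvd_zero (f : PP) (h : (X 0 : PP) ∣ f) (h0 : pderiv 0 f = 0) : f = 0 := by
  obtain ⟨g, rfl⟩ := h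
  have : g = 0 := by
    apply Eu_inj 1 0 0 1 one_pos
    rw [pderiv_mul, pderiv_X_self] at h0
    simp only [Eu]
    rw [← h0]; simp; ring
  simp [this]

lemma const_zero (f : PP) (h : constantCoeff f = 0) (h0 : pderiv 0 f = 0) (h1 : pderiv 1 f = 0)
    (h2 : pderiv 2 f = 0) : f = 0 := by
  apply Eu_const 1 1 1 one_pos one_pos one_pos f h
  simp [Eu, h0, h1, h2]

lemma decomp (f : PP) : ∃ f₀ f₁ : PP, pderiv 0 f₀ = 0 ∧ f = f₀ + X 0 * f₁ := by
  induction f using MvPolynomial.induction_on with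
  | C a => exact ⟨C a, 0, by simp, by simp⟩
  | add p q hp hq =>
    obtain ⟨a, b, h1, rfl⟩ := hp
    obtain ⟨a', b', h1', rfl⟩ := hq
    exact ⟨a + a', b + b', by simp [h1, h1'], by ring⟩
  | mul_X p i hp =>
    obtain ⟨a, b, h1, rfl⟩ := hp
    by_cases hi : i = 0
    · subst hi
      exact ⟨0, a + X 0 * b, by simp, by ring⟩
    · exact ⟨a * X i, b * X i, by simp [h1, pderiv_X_of_ne hi], by ring⟩

lemma poincare (P Q : PP) (hP : pderiv 0 P = 0) (hQ : pderiv 0 Q = 0)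
    (h : pderiv 1 P + pderiv 2 Q = 0) :
    ∃ H : PP, pderiv 0 H = 0 ∧ constantCoeff H = 0 ∧ pderiv 2 H = P ∧ pderiv 1 H = -Q := by
  obtain ⟨H, hH⟩ := Eu_solve 1 1 1 0 (X 2 * P - X 1 * Q) (by
    intro s hs
    have : s = 0 := by
      ext i
      fin_cases i <;> simp <;> omega
    subst this
    rw [← constantCoeff_eq]; simp)
  simp only [Eu, zero_smul, one_smul, add_zero] at hH
  have n01 : pderiv 0 (X 1 : PP) = 0 := pderiv_X_of_ne (by decide)
  have n02 : pderiv 0 (X 2 : PP) = 0 := pderiv_X_of_ne (by decide)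
  have n10 : pderiv 1 (X 0 : PP) = 0 := pderiv_X_of_ne (by decide)
  have n12 : pderiv 1 (X 2 : PP) = 0 := pderiv_X_of_ne (by decide)
  have n20 : pderiv 2 (X 0 : PP) = 0 := pderiv_X_of_ne (by decide)
  have n21 : pderiv 2 (X 1 : PP) = 0 := pderiv_X_of_ne (by decide)
  have k0 := congrArg (pderiv 0) hH
  have k1 := congrArg (pderiv 1) hH
  have k2 := congrArg (pderiv 2) hH
  simp only [map_add, map_sub, pderiv_mul, pderiv_X_self, n01, n02, n10, n12, n20, n21, hP, hQ]
    at k0 k1 k2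
  have c01 := pd_comm 0 1 H
  have c02 := pd_comm 0 2 H
  have c12 := pd_comm 1 2 H
  have hP' := pd_comm 0 1 P
  have e0 : pderiv 0 H = 0 := by
    apply Eu_inj 1 1 1 1 one_pos
    simp only [Eu, one_smul]
    rw [← c01, ← c02]
    linear_combination k0
  have e2 : pderiv 2 H - P = 0 := by
    apply Eu_inj 1 1 1 1 one_pos
    simp only [Eu, one_smul, map_sub, hP]
    linear_combination k2 - X 1 * h + X 0 * c02 + X 1 * c12
  have e1 : pderiv 1 H + Q = 0 := by
    apply Eu_inj 1 1 1 1 one_pos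
    simp only [Eu, one_smul, map_add, hQ]
    linear_combination k1 + X 2 * h + X 0 * c01 - X 2 * c12
  refine ⟨H - C (constantCoeff H), by simp [e0], by simp, ?_, ?_⟩
  · simp only [map_sub, pderiv_C, sub_zero]; exact sub_eq_zero.mp e2
  · simp only [map_sub, pderiv_C, sub_zero]; exact eq_neg_of_add_eq_zero_left e1

lemma X2_not_dvd (k l : ℕ) (hl : 2 ≤ l) : ¬ (X 2 : PP) ∣ X 1 ^ k + X 2 ^ l := by
  intro h
  rw [dvd_add_left (dvd_pow_self _ (by omega))] at h
  have := (X_prime (R := ℂ) (i := (2 : Fin 3))).dvd_of_dvd_pow h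
  rw [X_dvd_X] at this
  simp at this

lemma r0_ne (k l : ℕ) (hl : 2 ≤ l) : (X 1 ^ k + X 2 ^ l : PP) ≠ 0 := by
  intro h
  exact X2_not_dvd k l hl (h ▸ dvd_zero _)

lemma pd0_r0 (k l : ℕ) : pderiv 0 (X 1 ^ k + X 2 ^ l : PP) = 0 := by
  have n01 : pderiv 0 (X 1 : PP) = 0 := pderiv_X_of_ne (by decide)
  have n02 : pderiv 0 (X 2 : PP) = 0 := pderiv_X_of_ne (by decide)
  simp [n01, n02]

lemma cc_r0 (k l : ℕ) (hk : 2 ≤ k) (hl : 2 ≤ l) : constantCoeff (X 1 ^ k + X 2 ^ l : PP) = 0 := by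
  have : k ≠ 0 := by omega
  have : l ≠ 0 := by omega
  simp [*]

lemma divis (k l : ℕ) (hk : 2 ≤ k) (hl : 2 ≤ l) (h : PP) (h0 : pderiv 0 h = 0)
    (hc : constantCoeff h = 0)
    (hd : (X 1 ^ k + X 2 ^ l : PP) ∣
      (k : PP) * X 1 ^ (k - 1) * pderiv 2 h - (l : PP) * X 2 ^ (l - 1) * pderiv 1 h) :
    ∃ a : PP, pderiv 0 a = 0 ∧ h = a * (X 1 ^ k + X 2 ^ l) := by
  obtain ⟨k, rfl⟩ : ∃ m, k = m + 1 := ⟨k - 1, by omega⟩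
  obtain ⟨l, rfl⟩ : ∃ m, l = m + 1 := ⟨l - 1, by omega⟩
  simp only [Nat.add_sub_cancel] at hd
  set r0 : PP := X 1 ^ (k + 1) + X 2 ^ (l + 1) with hr0
  obtain ⟨w, hw⟩ := hd
  have e1 : X 2 ^ l * Eu 1 (l + 1) (k + 1) h = r0 * (((k + 1 : ℕ) : PP) * pderiv 2 h - X 1 * w) := by
    simp only [Eu, h0, nsmul_eq_mul]
    rw [mul_sub, mul_left_comm r0 (X 1) w, ← hw, hr0]
    ring
  have e2 : (X 2 : PP) ^ l ∣ r0 * (((k + 1 : ℕ) : PP) * pderiv 2 h - X 1 * w) := ⟨_, e1.symm⟩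
  obtain ⟨g, hg⟩ := (X_prime (R := ℂ) (i := (2 : Fin 3))).pow_dvd_of_dvd_mul_left l (X2_not_dvd _ _ hl) e2
  have e3 : Eu 1 (l + 1) (k + 1) h = r0 * g := by
    apply mul_left_cancel₀ (pow_ne_zero l (X_prime (R := ℂ) (i := (2 : Fin 3))).ne_zero)
    rw [e1, hg]; ring
  obtain ⟨a, ha⟩ := Eu_solve 1 (l + 1) (k + 1) ((k + 1) * (l + 1)) g (by
    intro s hs
    have : 0 < (k + 1) * (l + 1) := by positivity
    omega)
  have n01 : pderiv 0 (X 1 : PP) = 0 := pderiv_X_of_ne (by decide)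
  have n02 : pderiv 0 (X 2 : PP) = 0 := pderiv_X_of_ne (by decide)
  have n12 : pderiv 1 (X 2 : PP) = 0 := pderiv_X_of_ne (by decide)
  have n21 : pderiv 2 (X 1 : PP) = 0 := pderiv_X_of_ne (by decide)
  have hcr : constantCoeff r0 = 0 := cc_r0 _ _ hk hl
  have e4 : h - a * r0 = 0 := by
    apply Eu_const 1 (l + 1) (k + 1) one_pos (by omega) (by omega)
    · simp [hc, hcr]
    · have : Eu 1 (l + 1) (k + 1) (h - a * r0) = Eu 1 (l + 1) (k + 1) h - r0 * g := by
        rw [← ha, hr0]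
        simp only [Eu, map_sub, map_add, pderiv_mul, pderiv_pow, pderiv_X_self, n01, n02, n12, n21,
          nsmul_eq_mul, Nat.add_sub_cancel]
        push_cast
        ring
      rw [this, e3, sub_self]
  have e5 : h = a * r0 := sub_eq_zero.mp e4
  refine ⟨a, ?_, e5⟩
  have := congrArg (pderiv 0) e5
  rw [pderiv_mul, pd0_r0, h0, mul_zero, add_zero] at this
  exact (mul_eq_zero.mp this.symm).resolve_right (r0_ne _ _ hl)

lemma X0_not_dvd_r (k l : ℕ) (hl : 2 ≤ l) : ¬ (X 0 : PP) ∣ X 1 ^ k + X 2 ^ l + X 0 := by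
  intro h
  rw [dvd_add_left (dvd_refl _)] at h
  exact r0_ne k l hl (X0_dvd_zero _ h (pd0_r0 k l))

lemma qk_eq (d : ℕ) (f g : PP) : qk d f = qk d g ↔ (X 0 : PP) ^ d ∣ f - g := by
  rw [qk, Ideal.Quotient.mkₐ_eq_mk, Ideal.Quotient.eq, Idl, Ideal.mem_span_singleton]

lemma qk_surj (d : ℕ) (a : Qr d) : ∃ f, qk d f = a := Ideal.Quotient.mkₐ_surjective ℂ (Idl d) a

lemma rep (d j : ℕ) (φ : Qr d ≃ₐ[ℂ] Qr d) (h : MemA d j φ) (f : PP) :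
    ∃ g, φ (qk d f) = qk d (f + X 0 ^ j * g) := by
  obtain ⟨h0, p, q, h1, h2, -, h3, h4⟩ := h
  rw [Ideal.mem_span_singleton] at h3 h4
  have key : ∀ i, ∃ g, φ (qk d (X i)) = qk d (X i + X 0 ^ j * g) := by
    intro i
    fin_cases i
    · exact ⟨0, by simpa using h0⟩
    · obtain ⟨g, hg⟩ := h3
      exact ⟨g, by rw [← hg]; simpa using h1⟩
    · obtain ⟨g, hg⟩ := h4
      exact ⟨g, by rw [← hg]; simpa using h2⟩
  induction f using MvPolynomial.induction_on with
  | C a =>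
    refine ⟨0, ?_⟩
    have : (C a : PP) = algebraMap ℂ PP a := rfl
    rw [mul_zero, add_zero, this, AlgHom.commutes, AlgEquiv.commutes]
  | add p q hp hq =>
    obtain ⟨a, ha⟩ := hp
    obtain ⟨b, hb⟩ := hq
    refine ⟨a + b, ?_⟩
    rw [map_add, map_add, ha, hb, ← map_add]
    congr 1; ring
  | mul_X p i hp =>
    obtain ⟨a, ha⟩ := hp
    obtain ⟨b, hb⟩ := key i
    refine ⟨a * X i + p * b + X 0 ^ j * a * b, ?_⟩
    rw [map_mul, map_mul, ha, hb, ← map_mul]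
    congr 1; ring

lemma pq_dvd (d j : ℕ) (hjd : j + 1 ≤ d) (p p' a a' : PP) (h : qk d p = qk d p')
    (h1 : (X 0 : PP) ^ (j + 1) ∣ p - a) (h2 : (X 0 : PP) ^ (j + 1) ∣ p' - a') :
    (X 0 : PP) ^ (j + 1) ∣ a - a' := by
  have h3 := (pow_dvd_pow (X 0 : PP) hjd).trans ((qk_eq d p p').mp h)
  have := dvd_add (dvd_sub h3 h1) h2
  convert this using 1
  ring

lemma cancel_pow (j : ℕ) (f : PP) (h : (X 0 : PP) ^ (j + 1) ∣ f * X 0 ^ j) : (X 0 : PP) ∣ f := by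
  rw [pow_succ, mul_comm f] at h
  exact (mul_dvd_mul_iff_left (pow_ne_zero j (X_ne_zero (0 : Fin 3)))).mp h

lemma pd0_pd (i : Fin 3) (h : PP) (h0 : pderiv 0 h = 0) : pderiv 0 (pderiv i h) = 0 := by
  rw [pd_comm, h0, map_zero]

lemma ham_unique (j : ℕ) (h h' : PP) (h0 : pderiv 0 h = 0) (h0' : pderiv 0 h' = 0)
    (hc : constantCoeff h = 0) (hc' : constantCoeff h' = 0)
    (e1 : (X 0 : PP) ^ (j + 1) ∣ (X 1 + pderiv 2 h * X 0 ^ j) - (X 1 + pderiv 2 h' * X 0 ^ j))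
    (e2 : (X 0 : PP) ^ (j + 1) ∣ (X 2 - pderiv 1 h * X 0 ^ j) - (X 2 - pderiv 1 h' * X 0 ^ j)) :
    h = h' := by
  apply sub_eq_zero.mp
  apply const_zero
  · simp [hc, hc']
  · simp [h0, h0']
  · apply X0_dvd_zero
    · apply cancel_pow j
      rw [← dvd_neg]
      convert e2 using 1
      rw [map_sub]; ring
    · apply pd0_pd; simp [h0, h0']
  · apply X0_dvd_zero
    · apply cancel_pow j
      convert e1 using 1
      rw [map_sub]; ring
    · apply pd0_pd; simp [h0, h0']

lemma relPhi_unique (d j : ℕ) (hjd : j + 1 ≤ d) (φ : Qr d ≃ₐ[ℂ] Qr d) (h h' : PP)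
    (H : RelPhi d j φ h) (H' : RelPhi d j φ h') : h = h' := by
  obtain ⟨h0, hc, p, q, h1, h2, h3, h4⟩ := H
  obtain ⟨h0', hc', p', q', h1', h2', h3', h4'⟩ := H'
  rw [Ideal.mem_span_singleton] at h3 h4 h3' h4'
  exact ham_unique j h h' h0 h0' hc hc' (pq_dvd d j hjd p p' _ _ (h1.symm.trans h1') h3 h3')
    (pq_dvd d j hjd q q' _ _ (h2.symm.trans h2') h4 h4')

lemma relPsi_eq (d j k l : ℕ) (hk : 2 ≤ k) (hl : 2 ≤ l) (φ : Qr d ≃ₐ[ℂ] Qr d) (α : PP)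
    (H : RelPsi d j (X 1 ^ k + X 2 ^ l) φ α) :
    pderiv 0 α = 0 ∧ RelPhi d j φ (α * (X 1 ^ k + X 2 ^ l)) := by
  obtain ⟨h0, h, c, h1, h2⟩ := H
  have h3 := congrArg constantCoeff h2
  rw [map_sub, map_mul, cc_r0 k l hk hl, h1.2.1, constantCoeff_C, mul_zero, sub_zero] at h3
  rw [← h3, C_0] at h2
  rw [← sub_eq_zero.mp h2]
  exact ⟨h0, h1⟩

lemma relPsi_of (d j k l : ℕ) (φ : Qr d ≃ₐ[ℂ] Qr d) (α : PP) (h0 : pderiv 0 α = 0)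
    (H : RelPhi d j φ (α * (X 1 ^ k + X 2 ^ l))) :
    RelPsi d j (X 1 ^ k + X 2 ^ l) φ α :=
  ⟨h0, _, 0, H, by simp⟩

lemma part1 (d j k l : ℕ) (hj1 : 1 ≤ j) (hjd : j + 1 ≤ d) (hk : 2 ≤ k) (hl : 2 ≤ l)
    (φ : Qr d ≃ₐ[ℂ] Qr d) (H : MemAr d j (X 1 ^ k + X 2 ^ l + X 0) φ) :
    ∃ α, RelPsi d j (X 1 ^ k + X 2 ^ l) φ α := by
  obtain ⟨⟨h0, p, q, hp, hq, ⟨c, hc0, hc⟩, hp1, hq1⟩, hr⟩ := H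
  rw [Ideal.mem_span_singleton] at hp1 hq1 hr
  rw [Idl, Ideal.mem_span_singleton] at hc
  obtain ⟨P, hP⟩ := hp1
  obtain ⟨Q, hQ⟩ := hq1
  obtain ⟨P0, P1, hP0, rfl⟩ := decomp P
  obtain ⟨Q0, Q1, hQ0, rfl⟩ := decomp Q
  obtain ⟨j, rfl⟩ : ∃ m, j = m + 1 := ⟨j - 1, by omega⟩
  have n10 : pderiv 1 (X 0 : PP) = 0 := pderiv_X_of_ne (by decide)
  have n12 : pderiv 1 (X 2 : PP) = 0 := pderiv_X_of_ne (by decide)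
  have n20 : pderiv 2 (X 0 : PP) = 0 := pderiv_X_of_ne (by decide)
  have n21 : pderiv 2 (X 1 : PP) = 0 := pderiv_X_of_ne (by decide)
  have hp2 : p = X 1 + X 0 ^ (j + 1) * (P0 + X 0 * P1) := by rw [← hP]; ring
  have hq2 : q = X 2 + X 0 ^ (j + 1) * (Q0 + X 0 * Q1) := by rw [← hQ]; ring
  have hpb : ∃ s, pb p q = 1 + X 0 ^ (j + 1) * (pderiv 1 P0 + pderiv 2 Q0) + X 0 ^ (j + 2) * s := by
    refine ⟨pderiv 1 P1 + pderiv 2 Q1 +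
      X 0 ^ j * (pderiv 1 (P0 + X 0 * P1) * pderiv 2 (Q0 + X 0 * Q1) -
        pderiv 2 (P0 + X 0 * P1) * pderiv 1 (Q0 + X 0 * Q1)), ?_⟩
    rw [hp2, hq2, pb]
    simp only [map_add, pderiv_mul, pderiv_pow, pderiv_X_self, n10, n12, n20, n21]
    ring
  obtain ⟨s, hs⟩ := hpb
  have hc1 := (pow_dvd_pow (X 0 : PP) hjd).trans hc
  rw [hs] at hc1
  have hc2 : (1 - C c : PP) = 0 := by
    apply X0_dvd_zero
    · have := (dvd_pow_self (X 0 : PP) (Nat.succ_ne_zero (j + 1))).trans hc1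
      obtain ⟨y, hy⟩ := this
      exact ⟨y - X 0 ^ j * (pderiv 1 P0 + pderiv 2 Q0) - X 0 ^ (j + 1) * s, by
        linear_combination hy⟩
    · simp
  have hdiv : pderiv 1 P0 + pderiv 2 Q0 = 0 := by
    apply X0_dvd_zero
    · apply cancel_pow (j + 1)
      obtain ⟨y, hy⟩ := hc1
      exact ⟨y - s, by linear_combination hy - hc2⟩
    · rw [map_add, pd0_pd _ _ hP0, pd0_pd _ _ hQ0, add_zero]
  obtain ⟨h, hh0, hhc, hh2, hh1⟩ := poincare P0 Q0 hP0 hQ0 hdiv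
  have hφr : φ (qk d (X 1 ^ k + X 2 ^ l + X 0)) = qk d (p ^ k + q ^ l + X 0) := by
    simp only [map_add, map_pow, hp, hq, h0]
  rw [hφr] at hr
  obtain ⟨u, hu⟩ := hr
  obtain ⟨u, rfl⟩ := qk_surj d u
  rw [← map_mul, qk_eq] at hu
  have hu1 := (pow_dvd_pow (X 0 : PP) hjd).trans hu
  obtain ⟨A, hA⟩ := Polynomial.powAddExpansion (X 1 : PP) (X 0 ^ (j + 1) * (P0 + X 0 * P1)) k
  obtain ⟨B, hB⟩ := Polynomial.powAddExpansion (X 2 : PP) (X 0 ^ (j + 1) * (Q0 + X 0 * Q1)) l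
  rw [hp2, hq2, hA, hB] at hu1
  obtain ⟨y, hy⟩ := hu1
  set G : PP := (k : PP) * X 1 ^ (k - 1) * P0 + (l : PP) * X 2 ^ (l - 1) * Q0 with hG
  obtain ⟨S, hS⟩ : ∃ S, (X 1 ^ k + X 2 ^ l + X 0) * (u - 1) = X 0 ^ (j + 1) * (G + X 0 * S) :=
    ⟨(k : PP) * X 1 ^ (k - 1) * P1 + (l : PP) * X 2 ^ (l - 1) * Q1 + X 0 ^ j * (A * (P0 + X 0 * P1) ^ 2
      + B * (Q0 + X 0 * Q1) ^ 2) - y, by rw [hG]; linear_combination (-1 : PP) * hy⟩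
  obtain ⟨w, hw⟩ := (X_prime (R := ℂ) (i := (0 : Fin 3))).pow_dvd_of_dvd_mul_left (j + 1)
    (X0_not_dvd_r k l hl) ⟨_, hS⟩
  have hG2 : (X 1 ^ k + X 2 ^ l + X 0) * w = G + X 0 * S := by
    apply mul_left_cancel₀ (pow_ne_zero (j + 1) (X_ne_zero (R := ℂ) (0 : Fin 3)))
    rw [← hS, hw]; ring
  obtain ⟨w0, w1, hw0, rfl⟩ := decomp w
  have hG3 : G - (X 1 ^ k + X 2 ^ l) * w0 = 0 := by
    apply X0_dvd_zero
    · exact ⟨(X 1 ^ k + X 2 ^ l) * w1 + w0 + X 0 * w1 - S, by linear_combination (-1 : PP) * hG2⟩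
    · have n01 : pderiv 0 (X 1 : PP) = 0 := pderiv_X_of_ne (by decide)
      have n02 : pderiv 0 (X 2 : PP) = 0 := pderiv_X_of_ne (by decide)
      have nk : pderiv 0 (k : PP) = 0 := Derivation.map_natCast _ _
      have nl : pderiv 0 (l : PP) = 0 := Derivation.map_natCast _ _
      rw [hG]
      simp only [map_sub, map_add, pderiv_mul, pderiv_pow, n01, n02, hP0, hQ0, hw0, nk, nl]
      ring
  obtain ⟨α, hα, hα2⟩ := divis k l hk hl h hh0 hhc ⟨w0, by
    rw [← sub_eq_zero, ← hG3, hG, hh2, hh1]; ring⟩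
  refine ⟨α, relPsi_of _ _ _ _ _ _ hα ?_⟩
  rw [← hα2]
  refine ⟨hh0, hhc, p, q, hp, hq, ?_, ?_⟩ <;> rw [Ideal.mem_span_singleton]
  · exact ⟨P1, by rw [hp2, hh2]; ring⟩
  · exact ⟨Q1, by rw [hq2, hh1]; ring⟩

lemma part2 (d j : ℕ) (hj1 : 1 ≤ j) (φ ψ : Qr d ≃ₐ[ℂ] Qr d) (h h' : PP)
    (Hφ : MemA d j φ) (h1 : RelPhi d j φ h) (h2 : RelPhi d j ψ h') :
    RelPhi d j (φ * ψ) (h + h') := by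
  obtain ⟨a0, ac, p, q, a1, a2, a3, a4⟩ := h1
  obtain ⟨b0, bc, p', q', b1, b2, b3, b4⟩ := h2
  rw [Ideal.mem_span_singleton] at a3 a4 b3 b4
  obtain ⟨A, hA⟩ := a3
  obtain ⟨B, hB⟩ := a4
  obtain ⟨A', hA'⟩ := b3
  obtain ⟨B', hB'⟩ := b4
  obtain ⟨j, rfl⟩ : ∃ m, j = m + 1 := ⟨j - 1, by omega⟩
  obtain ⟨g2, hg2⟩ := rep d _ φ Hφ (pderiv 2 h')
  obtain ⟨g1, hg1⟩ := rep d _ φ Hφ (pderiv 1 h')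
  obtain ⟨gA, hgA⟩ := rep d _ φ Hφ A'
  obtain ⟨gB, hgB⟩ := rep d _ φ Hφ B'
  have hx : φ (qk d (X 0)) = qk d (X 0) := Hφ.1
  have e1 : p' = X 1 + pderiv 2 h' * X 0 ^ (j + 1) + X 0 ^ (j + 1 + 1) * A' := by rw [← hA']; ring
  have e2 : q' = X 2 - pderiv 1 h' * X 0 ^ (j + 1) + X 0 ^ (j + 1 + 1) * B' := by rw [← hB']; ring
  refine ⟨by simp [a0, b0], by simp [ac, bc],
    p + (pderiv 2 h' + X 0 ^ (j + 1) * g2) * X 0 ^ (j + 1)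
      + X 0 ^ (j + 1 + 1) * (A' + X 0 ^ (j + 1) * gA),
    q - (pderiv 1 h' + X 0 ^ (j + 1) * g1) * X 0 ^ (j + 1)
      + X 0 ^ (j + 1 + 1) * (B' + X 0 ^ (j + 1) * gB), ?_, ?_, ?_, ?_⟩
  · rw [AlgEquiv.mul_apply, b1, e1]
    simp only [map_add, map_mul, map_pow, hx, a1] at hg2 hgA ⊢
    rw [hg2, hgA]
  · rw [AlgEquiv.mul_apply, b2, e2]
    simp only [map_add, map_sub, map_mul, map_pow, hx, a2] at hg1 hgB ⊢
    rw [hg1, hgB]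
  · rw [Ideal.mem_span_singleton]
    refine ⟨A + X 0 ^ j * g2 + (A' + X 0 ^ (j + 1) * gA), ?_⟩
    rw [map_add]
    linear_combination hA
  · rw [Ideal.mem_span_singleton]
    refine ⟨B - X 0 ^ j * g1 + (B' + X 0 ^ (j + 1) * gB), ?_⟩
    rw [map_add]
    linear_combination hB

lemma part3 (d j k l : ℕ) (hjd : j + 1 ≤ d) (hk : 2 ≤ k) (hl : 2 ≤ l)
    (φ : Qr d ≃ₐ[ℂ] Qr d) (α : PP) (H : MemAr d j (X 1 ^ k + X 2 ^ l + X 0) φ)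
    (hα : RelPsi d j (X 1 ^ k + X 2 ^ l) φ α) :
    α = 0 ↔ MemAr d (j + 1) (X 1 ^ k + X 2 ^ l + X 0) φ := by
  obtain ⟨hα0, hα1⟩ := relPsi_eq d j k l hk hl φ α hα
  constructor
  · rintro rfl
    rw [zero_mul] at hα1
    obtain ⟨-, -, p, q, h1, h2, h3, h4⟩ := hα1
    obtain ⟨⟨g0, p', q', g1, g2, g3, g4, g5⟩, hr⟩ := H
    rw [Ideal.mem_span_singleton] at h3 h4
    have hd := pow_dvd_pow (X 0 : PP) hjd
    refine ⟨⟨g0, p', q', g1, g2, g3, ?_, ?_⟩, hr⟩ <;> rw [Ideal.mem_span_singleton]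
    · have h5 := hd.trans ((qk_eq d p' p).mp (g1.symm.trans h1))
      convert dvd_add h5 h3 using 1
      simp
    · have h5 := hd.trans ((qk_eq d q' q).mp (g2.symm.trans h2))
      convert dvd_add h5 h4 using 1
      simp
  · rintro ⟨⟨g0, p', q', g1, g2, g3, g4, g5⟩, hr⟩
    have : RelPhi d j φ 0 := ⟨by simp, by simp, p', q', g1, g2, by simpa using g4, by simpa using g5⟩
    have := relPhi_unique d j hjd φ _ _ hα1 this
    exact (mul_eq_zero.mp this).resolve_right (r0_ne k l hl)

section expo
open IsNilpotent TensorProduct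

/-- Exponentials of nilpotent endomorphisms respect bilinear maps for which they are
derivations. -/
lemma exp_bilin (R B : Type*) [CommRing R] [AddCommGroup B]
    [Module R B] [Module ℚ B] (b : B →ₗ[R] B →ₗ[R] B)
    (D : B →ₗ[R] B) (h_der : ∀ x y, D (b x y) = b x (D y) + b (D x) y)
    (h_nil : IsNilpotent D) (x y : B) :
    exp D (b x y) = b (exp D x) (exp D y) := by
  let DL : Module.End R (B ⊗[R] B) := D.lTensor B
  let DR : Module.End R (B ⊗[R] B) := D.rTensor B
  have h_nilL : IsNilpotent DL := h_nil.map <| Module.End.lTensorAlgHom R B B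
  have h_nilR : IsNilpotent DR := h_nil.map <| Module.End.rTensorAlgHom R B B
  have h_comm : Commute DL DR := by ext; simp [DL, DR]
  set m : B ⊗[R] B →ₗ[R] B := TensorProduct.lift b with hm
  have h₁ : exp D (b x y) = m (exp (DL + DR) (x ⊗ₜ[R] y)) := by
    suffices exp D ∘ₗ m = m ∘ₗ exp (DL + DR) by
      have := LinearMap.congr_fun this (x ⊗ₜ[R] y)
      simpa [hm] using this
    apply Module.End.commute_exp_left_of_commute (h_comm.isNilpotent_add h_nilL h_nilR) h_nil
    ext
    simp [DL, DR, hm, h_der]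
  have h₂ : exp DL = (exp D).lTensor B := (h_nil.map_exp (Module.End.lTensorAlgHom R B B)).symm
  have h₃ : exp DR = (exp D).rTensor B := (h_nil.map_exp (Module.End.rTensorAlgHom R B B)).symm
  simp [h₁, exp_add_of_commute h_comm h_nilL h_nilR, h₂, h₃, hm]

end expo

lemma descend (d : ℕ) (T : PP →ₗ[ℂ] PP)
    (h : ∀ f, (X 0 : PP) ^ d ∣ f → (X 0 : PP) ^ d ∣ T f) :
    ∃ L : Qr d →ₗ[ℂ] Qr d, ∀ f, L (qk d f) = qk d (T f) := by
  choose s hs using qk_surj d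
  have key : ∀ a f, qk d f = a → qk d (T (s a)) = qk d (T f) := by
    intro a f hf
    rw [qk_eq, ← map_sub]
    apply h
    rw [← qk_eq, hs, hf]
  refine ⟨{ toFun := fun a => qk d (T (s a)), map_add' := ?_, map_smul' := ?_ }, ?_⟩
  · intro a b
    rw [key (a + b) (s a + s b) (by rw [map_add, hs, hs]), map_add, map_add]
  · intro c a
    rw [key (c • a) (c • s a) (by rw [map_smul, hs]), map_smul, map_smul]
    rfl
  · intro f
    exact key _ f rfl

lemma pd_pow_X0 (i : Fin 3) (hi : i ≠ 0) (n : ℕ) (g : PP) :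
    pderiv i (X 0 ^ n * g) = X 0 ^ n * pderiv i g := by
  have : pderiv i (X 0 : PP) = 0 := pderiv_X_of_ne hi.symm
  rw [pderiv_mul, pderiv_pow, this]; ring

lemma pb_pow_X0 (n : ℕ) (f g : PP) : pb (X 0 ^ n * f) g = X 0 ^ n * pb f g := by
  rw [pb, pb, pd_pow_X0 1 (by decide), pd_pow_X0 2 (by decide)]; ring

/-- The derivation `x^j {·, F}`. -/
noncomputable def TD (j : ℕ) (F : PP) : PP →ₗ[ℂ] PP where
  toFun f := X 0 ^ j * pb f F
  map_add' f g := by simp only [pb, map_add]; ring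
  map_smul' c f := by
    simp only [pb, smul_eq_C_mul, RingHom.id_apply, pderiv_C_mul]; ring

lemma TD_apply (j : ℕ) (F f : PP) : TD j F f = X 0 ^ j * pb f F := rfl

set_option maxHeartbeats 2000000 in
lemma exists_auto (d j : ℕ) (hj : 1 ≤ j) (F r : PP) (hF : r ∣ pb r F) :
    ∃ φ : Qr d ≃ₐ[ℂ] Qr d, φ (qk d (X 0)) = qk d (X 0) ∧
      (∀ f, ∃ g, φ (qk d f) = qk d (f + X 0 ^ j * pb f F + X 0 ^ (2 * j) * g)) ∧
      (∀ f g p q, φ (qk d f) = qk d p → φ (qk d g) = qk d q → φ (qk d (pb f g)) = qk d (pb p q)) ∧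
      φ (qk d r) ∈ Ideal.span {qk d r} := by
  obtain ⟨D, hD⟩ := descend d (TD j F) (by
    rintro _ ⟨g, rfl⟩
    rw [TD_apply, pb_pow_X0]
    exact Dvd.intro _ (by ring : X 0 ^ d * (X 0 ^ j * pb g F) = _))
  obtain ⟨D1, hD1⟩ := descend d (pderiv 1 : Derivation ℂ PP PP).toLinearMap (by
    rintro _ ⟨g, rfl⟩
    exact ⟨pderiv 1 g, pd_pow_X0 1 (by decide) d g⟩)
  obtain ⟨D2, hD2⟩ := descend d (pderiv 2 : Derivation ℂ PP PP).toLinearMap (by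
    rintro _ ⟨g, rfl⟩
    exact ⟨pderiv 2 g, pd_pow_X0 2 (by decide) d g⟩)
  replace hD1 : ∀ f, D1 (qk d f) = qk d (pderiv 1 f) := hD1
  replace hD2 : ∀ f, D2 (qk d f) = qk d (pderiv 2 f) := hD2
  have n10 : pderiv 1 (X 0 : PP) = 0 := pderiv_X_of_ne (by decide)
  have n20 : pderiv 2 (X 0 : PP) = 0 := pderiv_X_of_ne (by decide)
  have hpow : ∀ n f, ∃ g, (D ^ n) (qk d f) = qk d (X 0 ^ (j * n) * g) := by
    intro n
    induction n with
    | zero => intro f; exact ⟨f, by simp⟩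
    | succ n ih =>
      intro f
      obtain ⟨g, hg⟩ := ih f
      refine ⟨pb g F, ?_⟩
      rw [pow_succ', Module.End.mul_apply, hg, hD, TD_apply, pb_pow_X0]
      congr 1; ring
  have hzero : ∀ n, d ≤ n → D ^ n = 0 := by
    intro n hn
    refine LinearMap.ext fun a => ?_
    obtain ⟨f, rfl⟩ := qk_surj d a
    obtain ⟨g, hg⟩ := hpow n f
    rw [hg, LinearMap.zero_apply, ← map_zero (qk d), qk_eq, sub_zero]
    exact (pow_dvd_pow _ (by nlinarith)).mul_right g
  have hnil : IsNilpotent D := ⟨d, hzero d le_rfl⟩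
  have hmul : ∀ x y, D (x * y) = x * D y + D x * y := by
    intro x y
    obtain ⟨f, rfl⟩ := qk_surj d x
    obtain ⟨g, rfl⟩ := qk_surj d y
    rw [← map_mul, hD, hD, hD, ← map_mul, ← map_mul, ← map_add]
    congr 1
    simp only [TD_apply, pb, pderiv_mul]; ring
  let b : Qr d →ₗ[ℂ] Qr d →ₗ[ℂ] Qr d :=
    (LinearMap.mul ℂ (Qr d)).compl₁₂ D1 D2 - (LinearMap.mul ℂ (Qr d)).compl₁₂ D2 D1
  have hb : ∀ f g, b (qk d f) (qk d g) = qk d (pb f g) := by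
    intro f g
    simp only [b, LinearMap.sub_apply, LinearMap.compl₁₂_apply, LinearMap.mul_apply', hD1, hD2, pb,
      map_sub, map_mul]
  have hbder : ∀ x y, D (b x y) = b x (D y) + b (D x) y := by
    intro x y
    obtain ⟨f, rfl⟩ := qk_surj d x
    obtain ⟨g, rfl⟩ := qk_surj d y
    rw [hb, hD, hD, hD, hb, hb, ← map_add]
    congr 1
    simp only [TD_apply, pb, pderiv_mul, pderiv_pow, map_sub, n10, n20]
    rw [pd_comm 2 1 f, pd_comm 2 1 g, pd_comm 2 1 F]
    ring
  have hexp0 : ∀ a, D a = 0 → IsNilpotent.exp D a = a := by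
    intro a ha
    have := IsNilpotent.exp_smul_eq_sum (a := D) (m := a) (k := 1) (by simpa using ha) hnil
    simpa using this
  have h1 : D 1 = 0 := by
    rw [← map_one (qk d), hD, TD_apply, pb]; simp
  have hem : ∀ x y, IsNilpotent.exp D (x * y) = IsNilpotent.exp D x * IsNilpotent.exp D y :=
    Module.End.exp_mul_of_derivation ℂ (Qr d) D hmul hnil
  let φ0 : Qr d →ₐ[ℂ] Qr d := AlgHom.ofLinearMap (IsNilpotent.exp D) (hexp0 1 h1) hem
  have hbij : Function.Bijective φ0 := (Module.End.isUnit_iff _).mp (IsNilpotent.isUnit_exp hnil)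
  let φ := AlgEquiv.ofBijective φ0 hbij
  have hφ : ∀ a, φ a = IsNilpotent.exp D a := fun a => rfl
  have hsum : ∀ a, φ a = a + D a + ∑ i ∈ Finset.range d, ((i + 2).factorial : ℚ)⁻¹ • (D ^ (i + 2)) a := by
    intro a
    rw [hφ, IsNilpotent.exp_eq_sum (hzero (d + 2) (by omega)), Finset.sum_range_succ',
      Finset.sum_range_succ']
    simp [LinearMap.sum_apply]
    ring
  have hmem : ∀ (I : Ideal (Qr d)) (c : ℚ) (a : Qr d), a ∈ I → c • a ∈ I := by
    intro I c a ha
    exact Submodule.smul_of_tower_mem I c ha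
  refine ⟨φ, ?_, ?_, ?_, ?_⟩
  · rw [hφ]
    apply hexp0
    rw [hD, TD_apply, pb, n10, n20]; simp
  · intro f
    have : ∑ i ∈ Finset.range d, ((i + 2).factorial : ℚ)⁻¹ • (D ^ (i + 2)) (qk d f)
        ∈ Ideal.span {qk d (X 0 ^ (2 * j))} := by
      apply Submodule.sum_mem
      intro i _
      apply hmem
      obtain ⟨g, hg⟩ := hpow (i + 2) f
      rw [hg, Ideal.mem_span_singleton]
      apply map_dvd
      exact (pow_dvd_pow _ (by nlinarith)).mul_right g
    rw [Ideal.mem_span_singleton] at this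
    obtain ⟨y, hy⟩ := this
    obtain ⟨g, rfl⟩ := qk_surj d y
    refine ⟨g, ?_⟩
    rw [hsum, hy, hD, TD_apply, map_add, map_add, map_mul (qk d) (X 0 ^ (2 * j)) g]
  · intro f g p q hp hq
    rw [← hb, ← hb, ← hp, ← hq]
    exact exp_bilin ℂ (Qr d) b D hbder hnil _ _
  · have hDI : ∀ a ∈ Ideal.span {qk d r}, D a ∈ Ideal.span {qk d r} := by
      intro a ha
      rw [Ideal.mem_span_singleton] at ha ⊢
      obtain ⟨y, rfl⟩ := ha
      rw [hmul, hD, TD_apply]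
      apply dvd_add (dvd_mul_right _ _)
      apply Dvd.dvd.mul_right
      apply map_dvd
      exact hF.mul_left _
    have hDn : ∀ n, (D ^ n) (qk d r) ∈ Ideal.span {qk d r} := by
      intro n
      induction n with
      | zero => simpa using Ideal.mem_span_singleton_self _
      | succ n ih => rw [pow_succ', Module.End.mul_apply]; exact hDI _ ih
    rw [hsum]
    refine add_mem (add_mem (by simpa using hDn 0) (by simpa using hDn 1)) ?_
    exact Submodule.sum_mem _ fun i _ => hmem _ _ _ (hDn _)

lemma part4 (d j k l : ℕ) (hj1 : 1 ≤ j) (hk : 2 ≤ k) (hl : 2 ≤ l) (α : PP)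
    (hα : pderiv 0 α = 0) :
    ∃ φ : Qr d ≃ₐ[ℂ] Qr d, MemAr d j (X 1 ^ k + X 2 ^ l + X 0) φ ∧
      RelPsi d j (X 1 ^ k + X 2 ^ l) φ α := by
  have n10 : pderiv 1 (X 0 : PP) = 0 := pderiv_X_of_ne (by decide)
  have n12 : pderiv 1 (X 2 : PP) = 0 := pderiv_X_of_ne (by decide)
  have n20 : pderiv 2 (X 0 : PP) = 0 := pderiv_X_of_ne (by decide)
  have n21 : pderiv 2 (X 1 : PP) = 0 := pderiv_X_of_ne (by decide)
  set r0 : PP := X 1 ^ k + X 2 ^ l with hr0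
  obtain ⟨φ, hx, hφ, hpb, hr⟩ := exists_auto d j hj1 (α * (r0 + X 0)) (r0 + X 0)
    ⟨pb (r0 + X 0) α, by simp only [pb, pderiv_mul]; ring⟩
  obtain ⟨A, hA⟩ := hφ (X 1)
  obtain ⟨B, hB⟩ := hφ (X 2)
  have hpz : pb (X 1) (α * (r0 + X 0)) = pderiv 2 (α * r0) + X 0 * pderiv 2 α := by
    simp only [pb, pderiv_X_self, n21, pderiv_mul, map_add, n20]; ring
  have hpt : pb (X 2) (α * (r0 + X 0)) = -pderiv 1 (α * r0) - X 0 * pderiv 1 α := by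
    simp only [pb, pderiv_X_self, n12, pderiv_mul, map_add, n10]; ring
  rw [hpz] at hA
  rw [hpt] at hB
  obtain ⟨j, rfl⟩ : ∃ m, j = m + 1 := ⟨j - 1, by omega⟩
  refine ⟨φ, ⟨⟨hx, _, _, hA, hB, ⟨1, one_ne_zero, ?_⟩, ?_, ?_⟩, hr⟩, ?_⟩
  · have h1 := hpb _ _ _ _ hA hB
    have h2 : pb (X 1) (X 2) = 1 := by simp [pb, n12, n21]
    rw [h2, map_one, map_one, ← map_one (qk d), qk_eq] at h1
    rw [Idl, Ideal.mem_span_singleton, C_1, ← neg_sub, dvd_neg]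
    exact h1
  · rw [Ideal.mem_span_singleton]
    exact ⟨pderiv 2 (α * r0) + X 0 * pderiv 2 α + X 0 ^ (j + 1) * A, by ring⟩
  · rw [Ideal.mem_span_singleton]
    exact ⟨-pderiv 1 (α * r0) - X 0 * pderiv 1 α + X 0 ^ (j + 1) * B, by ring⟩
  · apply relPsi_of _ _ _ _ _ _ hα
    rw [← hr0]
    refine ⟨?_, ?_, _, _, hA, hB, ?_, ?_⟩
    · rw [pderiv_mul, hα, pd0_r0]; simp
    · rw [map_mul, cc_r0 k l hk hl, mul_zero]
    · rw [Ideal.mem_span_singleton]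
      exact ⟨pderiv 2 α + X 0 ^ j * A, by ring⟩
    · rw [Ideal.mem_span_singleton]
      exact ⟨-pderiv 1 α + X 0 ^ j * B, by ring⟩

/-- For `r = z^k + t^l + x` (`k,l ≥ 2` coprime) and `1 ≤ j ≤ d-1`, the map
`Ψ_j : Ā_j(r) → ℂ[z,t]` is a well-defined surjective group homomorphism with
kernel `Ā_{j+1}(r)`; hence `Ā_j(r)/Ā_{j+1}(r) ≅ (ℂ[z,t], +)`. -/
theorem Psi_j_hom (d j k l : ℕ) (hd : 2 ≤ d) (hj1 : 1 ≤ j) (hjd : j ≤ d - 1)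
    (hk : 2 ≤ k) (hl : 2 ≤ l) (hkl : Nat.Coprime k l) :
    let r : MvPolynomial (Fin 3) ℂ := X 1 ^ k + X 2 ^ l + X 0
    let r₀ : MvPolynomial (Fin 3) ℂ := X 1 ^ k + X 2 ^ l
    (∀ φ : Qr d ≃ₐ[ℂ] Qr d, MemAr d j r φ →
      ∃ α, RelPsi d j r₀ φ α ∧ ∀ α', RelPsi d j r₀ φ α' → α' = α) ∧
    (∀ (φ ψ : Qr d ≃ₐ[ℂ] Qr d) (α β : MvPolynomial (Fin 3) ℂ),
      MemAr d j r φ → MemAr d j r ψ → RelPsi d j r₀ φ α → RelPsi d j r₀ ψ β →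
        RelPsi d j r₀ (φ * ψ) (α + β)) ∧
    (∀ (φ : Qr d ≃ₐ[ℂ] Qr d) (α : MvPolynomial (Fin 3) ℂ),
      MemAr d j r φ → RelPsi d j r₀ φ α → (α = 0 ↔ MemAr d (j + 1) r φ)) ∧
    (∀ α : MvPolynomial (Fin 3) ℂ, pderiv 0 α = 0 →
      ∃ φ : Qr d ≃ₐ[ℂ] Qr d, MemAr d j r φ ∧ RelPsi d j r₀ φ α) := by
  intro r r₀
  have hjd' : j + 1 ≤ d := by omega
  refine ⟨?_, ?_, ?_, ?_⟩
  · intro φ H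
    obtain ⟨α, hα⟩ := part1 d j k l hj1 hjd' hk hl φ H
    refine ⟨α, hα, ?_⟩
    intro α' hα'
    have h1 := (relPsi_eq d j k l hk hl φ α hα).2
    have h2 := (relPsi_eq d j k l hk hl φ α' hα').2
    exact mul_right_cancel₀ (r0_ne k l hl) (relPhi_unique d j hjd' φ _ _ h2 h1)
  · intro φ ψ α β Hφ Hψ h1 h2
    have e1 := relPsi_eq d j k l hk hl φ α h1
    have e2 := relPsi_eq d j k l hk hl ψ β h2
    apply relPsi_of
    · rw [map_add, e1.1, e2.1, add_zero]
    · rw [add_mul]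
      exact part2 d j hj1 φ ψ _ _ Hφ.1 e1.2 e2.2
  · intro φ α H hα
    exact part3 d j k l hjd' hk hl φ α H hα
  · intro α hα
    exact part4 d j k l hj1 hk hl α hα
end

section
/- Let d ≥ 2 and k,l ≥ 2 coprime, and set r = z^k + t^l + x and R̄ = ℂ[x]/(x^d). Then the group Ā_1(r) of special R̄-automorphisms of R̄[z,t] congruent to the identity mod (x) and preserving the ideal (r) is generated by the automorphisms exp(x·D_{γr}) for γ ∈ R̄[z,t], where D_H(f) = H_z·f_t - H_t·f_z. -/
open MvPolynomial

open Finset in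
/-- The set of exponential automorphisms `exp(x·D_{γr})` of `R̄[z,t]`, for
`γ ∈ R̄[z,t]`, described by their action on representatives. -/
def ExpGensR (d : ℕ) (r : MvPolynomial (Fin 3) ℂ) : Set (Qr d ≃ₐ[ℂ] Qr d) :=
  {φ | ∃ γ : MvPolynomial (Fin 3) ℂ,
    ∀ f : MvPolynomial (Fin 3) ℂ,
      φ (qk d f) =
        qk d (∑ n ∈ range d,
          ((n.factorial : ℂ)⁻¹) • (fun g => X 0 * pb (γ * r) g)^[n] f)}


namespace AbarAux

abbrev P3 := MvPolynomial (Fin 3) ℂ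

/-- antiderivative in the variable `i` -/
noncomputable def antider (i : Fin 3) : P3 →ₗ[ℂ] P3 :=
  (MvPolynomial.basisMonomials (Fin 3) ℂ).constr ℂ
    (fun s => monomial (s + Finsupp.single i 1) (((s i : ℂ) + 1)⁻¹))

lemma antider_monomial (i : Fin 3) (s : Fin 3 →₀ ℕ) (a : ℂ) :
    antider i (monomial s a) = monomial (s + Finsupp.single i 1) (a * ((s i : ℂ) + 1)⁻¹) := by
  have h1 : (monomial s a : P3) = a • MvPolynomial.basisMonomials (Fin 3) ℂ s := by
    simp [MvPolynomial.coe_basisMonomials, smul_monomial]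
  rw [h1, map_smul, antider, Module.Basis.constr_basis, smul_monomial, smul_eq_mul]

lemma pderiv_antider (i : Fin 3) (f : P3) : pderiv i (antider i f) = f := by
  induction f using MvPolynomial.induction_on' with
  | monomial s a =>
    rw [antider_monomial, pderiv_monomial]
    have : (s + Finsupp.single i 1) - Finsupp.single i 1 = s := by
      ext j; simp
    rw [this]
    congr 1
    have h : ((s i : ℂ) + 1) ≠ 0 := Nat.cast_add_one_ne_zero _
    simp
    field_simp
  | add p q hp hq => rw [map_add, map_add, hp, hq]

lemma pderiv_antider_ne (i j : Fin 3) (hij : i ≠ j) (f : P3) :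
    pderiv j (antider i f) = antider i (pderiv j f) := by
  induction f using MvPolynomial.induction_on' with
  | monomial s a =>
    rw [antider_monomial, pderiv_monomial, pderiv_monomial, antider_monomial]
    by_cases hs : s j = 0
    · simp [hs, Finsupp.single_apply, hij]
    · have h1 : (s + Finsupp.single i 1) - Finsupp.single j 1
          = s - Finsupp.single j 1 + Finsupp.single i 1 := by
        ext m
        by_cases hm : m = j
        · subst hm
          simp [Finsupp.single_apply, hij]
        · have : j ≠ m := fun h => hm h.symm
          simp [Finsupp.single_apply, this]
      rw [h1]
      congr 1
      have : j ≠ i := hij.symm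
      simp [Finsupp.single_apply, hij, this]
      ring
  | add p q hp hq => simp only [map_add, hp, hq]

lemma pderiv_comm' (f : P3) : pderiv 1 (pderiv 2 f) = pderiv 2 (pderiv 1 f) := by
  induction f using MvPolynomial.induction_on with
  | C a => simp
  | add p q hp hq => simp only [map_add, hp, hq]
  | mul_X p i hp =>
    fin_cases i <;> simp [pderiv_mul, hp, pderiv_X, Pi.single_apply] <;> ring

lemma poincare (a b : P3) (h : pderiv 1 a + pderiv 2 b = 0) :
    ∃ H : P3, a = - pderiv 2 H ∧ b = pderiv 1 H := by
  have h2 : pderiv 1 (a + pderiv 2 (antider 1 b)) = 0 := by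
    rw [map_add, pderiv_comm', pderiv_antider, h]
  refine ⟨antider 1 b - antider 2 (a + pderiv 2 (antider 1 b)), ?_, ?_⟩
  · rw [map_sub, pderiv_antider]; ring
  · rw [map_sub, pderiv_antider, pderiv_antider_ne _ _ (by decide), h2]; simp

/-- the parametrisation of the curve -/
noncomputable def psi (k l : ℕ) (w : ℂ) : P3 →ₐ[ℂ] Polynomial ℂ :=
  aeval ![0, Polynomial.X ^ l, Polynomial.C w * Polynomial.X ^ k]

lemma psi_X0 (k l : ℕ) (w : ℂ) : psi k l w (X 0) = 0 := by simp [psi]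
lemma psi_X1 (k l : ℕ) (w : ℂ) : psi k l w (X 1) = Polynomial.X ^ l := by simp [psi]
lemma psi_X2 (k l : ℕ) (w : ℂ) : psi k l w (X 2) = Polynomial.C w * Polynomial.X ^ k := by
  simp [psi]

lemma psi_deriv (k l : ℕ) (w : ℂ) (f : P3) :
    Polynomial.derivative (psi k l w f) =
      psi k l w (pderiv 1 f) * Polynomial.derivative (Polynomial.X ^ l) +
      psi k l w (pderiv 2 f) * Polynomial.derivative (Polynomial.C w * Polynomial.X ^ k) := by
  induction f using MvPolynomial.induction_on with
  | C a => simp [psi]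
  | add p q hp hq => simp only [map_add, hp, hq]; ring
  | mul_X p i hp =>
    rw [map_mul, Polynomial.derivative_mul, hp, pderiv_mul, pderiv_mul]
    fin_cases i
    · simp [psi_X0, pderiv_X, Pi.single_apply]
    · simp [psi_X1, pderiv_X, Pi.single_apply]; ring
    · simp [psi_X2, pderiv_X, Pi.single_apply]; ring

lemma wd_aux {B : Type*} [CommRing B] [Algebra ℂ B] (z t : B) (v : ℂ) (k l a b m : ℕ)
    (hv : v ^ l = -1) (ht : t ^ l = - z ^ k) :
    (v ^ b) • (z ^ (a + k * m) * t ^ b) = (v ^ (b + l * m)) • (z ^ a * t ^ (b + l * m)) := by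
  rw [pow_add, pow_add, pow_add, pow_mul, pow_mul, pow_mul, hv, ht, Algebra.smul_def,
    Algebra.smul_def, neg_pow (z ^ k)]
  simp only [map_mul, map_pow, map_neg, map_one]
  have : ((-1 : B) ^ m) * (-1) ^ m = 1 := by rw [← mul_pow]; simp
  linear_combination (-(algebraMap ℂ B) v ^ b * z ^ a * (z ^ k) ^ m * t ^ b) * this

open Classical in
lemma psi_ker (k l : ℕ) (hk : 2 ≤ k) (hl : 2 ≤ l) (hkl : Nat.Coprime k l) (w : ℂ)
    (hw : w ^ l = -1) (f : P3) (hf : psi k l w f = 0) :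
    f ∈ Ideal.span {(X 0 : P3), X 1 ^ k + X 2 ^ l + X 0} := by
  set I : Ideal P3 := Ideal.span {(X 0 : P3), X 1 ^ k + X 2 ^ l + X 0} with hI
  have hw0 : w ≠ 0 := by
    rintro rfl
    rw [zero_pow (by omega)] at hw
    norm_num at hw
  let mk : P3 →ₐ[ℂ] P3 ⧸ I := Ideal.Quotient.mkₐ ℂ I
  have hx : mk (X 0) = 0 :=
    Ideal.Quotient.eq_zero_iff_mem.mpr (Ideal.subset_span (by simp))
  have hr : mk (X 1) ^ k + mk (X 2) ^ l = 0 := by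
    have : mk (X 1 ^ k + X 2 ^ l + X 0) = 0 :=
      Ideal.Quotient.eq_zero_iff_mem.mpr (Ideal.subset_span (by simp))
    simpa [hx] using this
  have ht : mk (X 2) ^ l = - mk (X 1) ^ k := by linear_combination hr
  let val : ℕ × ℕ → P3 ⧸ I := fun p => (w⁻¹ ^ p.2) • (mk (X 1) ^ p.1 * mk (X 2) ^ p.2)
  have wd0 : ∀ a b a' b' : ℕ, l * a + k * b = l * a' + k * b' → b ≤ b' →
      val (a, b) = val (a', b') := by
    intro a b a' b' h hb
    obtain ⟨e, rfl⟩ := Nat.exists_eq_add_of_le hb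
    have hdiv : l ∣ k * e := by
      have : l * a = l * a' + k * e := by rw [mul_add] at h; omega
      exact (Nat.dvd_add_right (dvd_mul_right l a')).mp (this ▸ dvd_mul_right l a)
    obtain ⟨m, rfl⟩ := hkl.symm.dvd_of_dvd_mul_left hdiv
    have ha : a = a' + k * m := by
      have : l * a = l * (a' + k * m) := by rw [mul_add] at h; linarith
      exact Nat.eq_of_mul_eq_mul_left (by omega) this
    subst ha
    simp only [val]
    have h1 : w⁻¹ ^ l = -1 := by rw [inv_pow, hw]; norm_num
    exact wd_aux (mk (X 1)) (mk (X 2)) w⁻¹ k l a' b m h1 ht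
  have wd : ∀ p q : ℕ × ℕ, l * p.1 + k * p.2 = l * q.1 + k * q.2 → val p = val q := by
    intro p q h
    rcases le_total p.2 q.2 with hb | hb
    · exact wd0 _ _ _ _ h hb
    · exact (wd0 _ _ _ _ h.symm hb).symm
  let g : ℕ → P3 ⧸ I := fun n =>
    if h : ∃ p : ℕ × ℕ, l * p.1 + k * p.2 = n then val h.choose else 0
  have hg : ∀ a b, g (l * a + k * b) = val (a, b) := by
    intro a b
    have h : ∃ p : ℕ × ℕ, l * p.1 + k * p.2 = l * a + k * b := ⟨(a, b), rfl⟩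
    simp only [g, dif_pos h]
    exact wd _ _ h.choose_spec
  let θ : Polynomial ℂ →ₗ[ℂ] P3 ⧸ I := (Polynomial.basisMonomials ℂ).constr ℂ g
  have hθ : ∀ (n : ℕ) (c : ℂ), θ (Polynomial.C c * Polynomial.X ^ n) = c • g n := by
    intro n c
    have : Polynomial.C c * Polynomial.X ^ n = c • Polynomial.basisMonomials ℂ n := by
      simp [Polynomial.coe_basisMonomials, Polynomial.C_mul_X_pow_eq_monomial,
        Polynomial.smul_monomial]
    rw [this, map_smul, Module.Basis.constr_basis]
  have key : ∀ f : P3, θ (psi k l w f) = mk f := by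
    intro f
    induction f using MvPolynomial.induction_on' with
    | monomial s a =>
      have hs : (monomial s a : P3) = C a * (X 0 ^ s 0 * X 1 ^ s 1 * X 2 ^ s 2) := by
        rw [monomial_eq, Finsupp.prod_fintype _ _ (by simp)]
        simp [Fin.prod_univ_three]
      rw [hs]
      by_cases h0 : s 0 = 0
      · rw [h0]
        have : psi k l w (C a * (X 0 ^ 0 * X 1 ^ s 1 * X 2 ^ s 2)) =
            Polynomial.C (a * w ^ s 2) * Polynomial.X ^ (l * s 1 + k * s 2) := by
          simp only [map_mul, map_pow, psi_X1, psi_X2, pow_zero, one_mul]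
          simp [psi]
          ring
        rw [this, hθ, hg]
        simp only [val, map_mul, map_pow, pow_zero, one_mul, smul_smul]
        rw [mul_assoc, ← mul_pow, mul_inv_cancel₀ hw0, one_pow, mul_one]
        rw [← map_pow, ← map_pow, ← map_mul, ← map_mul, ← map_smul, smul_eq_C_mul]
      · simp [psi_X0, hx, h0]
    | add p q hp hq => simp only [map_add, hp, hq]
  have := key f
  rw [hf, map_zero] at this
  exact Ideal.Quotient.eq_zero_iff_mem.mp this.symm

lemma exists_root (l : ℕ) (hl : 2 ≤ l) : ∃ w : ℂ, w ^ l = -1 :=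
  IsAlgClosed.exists_pow_nat_eq (-1) (by omega)

lemma curve (k l : ℕ) (hk : 2 ≤ k) (hl : 2 ≤ l) (hkl : Nat.Coprime k l) (H v y : P3)
    (h : - pderiv 2 H * ((k : P3) * X 1 ^ (k - 1)) + pderiv 1 H * ((l : P3) * X 2 ^ (l - 1))
      = v * (X 1 ^ k + X 2 ^ l + X 0) + X 0 * y) :
    ∃ (c : ℂ) (γ u : P3), H = C c + γ * (X 1 ^ k + X 2 ^ l + X 0) + X 0 * u := by
  obtain ⟨w, hw⟩ := exists_root l hl
  have hw0 : w ≠ 0 := by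
    rintro rfl
    rw [zero_pow (by omega)] at hw
    norm_num at hw
  obtain ⟨k, rfl⟩ : ∃ k', k = k' + 1 := ⟨k - 1, by omega⟩
  obtain ⟨l, rfl⟩ : ∃ l', l = l' + 1 := ⟨l - 1, by omega⟩
  have h1 := congrArg (psi (k+1) (l+1) w) h
  simp only [map_add, map_mul, map_neg, map_pow, psi_X0, psi_X1, psi_X2, map_natCast,
    add_tsub_cancel_right] at h1
  have hwC : (Polynomial.C w) ^ (l+1) = -1 := by rw [← map_pow, hw]; simp
  have h2 := psi_deriv (k+1) (l+1) w H
  simp only [Polynomial.derivative_C_mul, Polynomial.derivative_X_pow, map_natCast,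
    add_tsub_cancel_right] at h2
  have h3 : Polynomial.C w ^ l * Polynomial.X ^ (k * l) *
      Polynomial.derivative (psi (k+1) (l+1) w H) = 0 := by
    rw [h2]
    linear_combination h1 + (Polynomial.X ^ (k * (l+1)) * (psi (k+1) (l+1) w) (pderiv 2 H) *
      ((k+1 : ℕ) : Polynomial ℂ) + (psi (k+1) (l+1) w) v * Polynomial.X ^ ((k+1) * (l+1))) * hwC
  have h4 : Polynomial.derivative (psi (k+1) (l+1) w H) = 0 := by
    rcases mul_eq_zero.mp h3 with h | h
    · exfalso
      revert h
      simp [hw0]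
    · exact h
  have h5 := Polynomial.eq_C_of_derivative_eq_zero h4
  set c := (psi (k+1) (l+1) w H).coeff 0
  have h6 : psi (k+1) (l+1) w (H - C c) = 0 := by
    rw [map_sub, h5]
    simp [psi]
  have h7 := psi_ker (k+1) (l+1) hk hl hkl w hw _ h6
  obtain ⟨u, γ, h8⟩ := Ideal.mem_span_pair.mp h7
  exact ⟨c, γ, u, by linear_combination -h8⟩

lemma X0_prime : Prime (X 0 : P3) := MvPolynomial.X_prime

lemma r_not_dvd (k l : ℕ) (hl : 2 ≤ l) : ¬ (X 0 : P3) ∣ X 1 ^ k + X 2 ^ l + X 0 := by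
  rintro ⟨y, hy⟩
  have := congrArg (MvPolynomial.eval (![0, 1, 0] : Fin 3 → ℂ)) hy
  simp [show l ≠ 0 by omega] at this

lemma pow_expand (p y : P3) (k : ℕ) :
    ∃ s, (p + y) ^ k = p ^ k + y * ((k : P3) * p ^ (k - 1)) + y ^ 2 * s := by
  obtain ⟨s, hs⟩ := Polynomial.powAddExpansion p y k
  exact ⟨s, by rw [hs]; ring⟩

lemma key (d k l j : ℕ) (hj : 1 ≤ j) (hjd : j < d) (hk : 2 ≤ k) (hl : 2 ≤ l)
    (hkl : Nat.Coprime k l) (a b u : P3) (c : ℂ)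
    (hJ : pb (X 1 + X 0 ^ j * a) (X 2 + X 0 ^ j * b) - C c ∈ Idl d)
    (hr : (X 1 + X 0 ^ j * a) ^ k + (X 2 + X 0 ^ j * b) ^ l + X 0
      - u * (X 1 ^ k + X 2 ^ l + X 0) ∈ Idl d) :
    ∃ γ : P3, (X 0 : P3) ∣ a + pderiv 2 (γ * (X 1 ^ k + X 2 ^ l + X 0)) ∧
      (X 0 : P3) ∣ b - pderiv 1 (γ * (X 1 ^ k + X 2 ^ l + X 0)) := by
  set r : P3 := X 1 ^ k + X 2 ^ l + X 0 with hrdef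
  obtain ⟨J, hJ⟩ := Ideal.mem_span_singleton.mp hJ
  obtain ⟨w, hw⟩ := Ideal.mem_span_singleton.mp hr
  obtain ⟨e, rfl⟩ := Nat.exists_eq_add_of_lt hjd
  obtain ⟨j, rfl⟩ := Nat.exists_eq_add_of_le' hj
  have hX : (X 0 : P3) ^ (j+1) ≠ 0 := pow_ne_zero _ (X_ne_zero _)
  have d10 : pderiv 1 (X 0 ^ (j+1) : P3) = 0 := by
    rw [pderiv_pow, pderiv_X_of_ne (by decide)]; ring
  have d20 : pderiv 2 (X 0 ^ (j+1) : P3) = 0 := by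
    rw [pderiv_pow, pderiv_X_of_ne (by decide)]; ring
  have e11 : pderiv 1 (X 1 + X 0 ^ (j+1) * a : P3) = 1 + X 0 ^ (j+1) * pderiv 1 a := by
    rw [map_add, pderiv_mul, d10, pderiv_X_self]; ring
  have e21 : pderiv 2 (X 1 + X 0 ^ (j+1) * a : P3) = X 0 ^ (j+1) * pderiv 2 a := by
    rw [map_add, pderiv_mul, d20, pderiv_X_of_ne (by decide)]; ring
  have e12 : pderiv 1 (X 2 + X 0 ^ (j+1) * b : P3) = X 0 ^ (j+1) * pderiv 1 b := by
    rw [map_add, pderiv_mul, d10, pderiv_X_of_ne (by decide)]; ring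
  have e22 : pderiv 2 (X 2 + X 0 ^ (j+1) * b : P3) = 1 + X 0 ^ (j+1) * pderiv 2 b := by
    rw [map_add, pderiv_mul, d20, pderiv_X_self]; ring
  rw [pb, e11, e22, e21, e12] at hJ
  have hc : c = 1 := by
    have := congrArg (MvPolynomial.eval (0 : Fin 3 → ℂ)) hJ
    simp at this
    linear_combination -this
  rw [hc, C_1] at hJ
  have hdiv : pderiv 1 a + pderiv 2 b = X 0 * (X 0 ^ e * J -
      X 0 ^ j * (pderiv 1 a * pderiv 2 b - pderiv 2 a * pderiv 1 b)) := by
    apply mul_left_cancel₀ hX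
    linear_combination hJ
  set W := X 0 ^ e * J - X 0 ^ j * (pderiv 1 a * pderiv 2 b - pderiv 2 a * pderiv 1 b)
  have hX01 : pderiv 1 (X 0 * antider 1 W) = X 0 * W := by
    rw [pderiv_mul, pderiv_antider, pderiv_X_of_ne (by decide)]; ring
  obtain ⟨H, ha, hb⟩ := poincare (a - X 0 * antider 1 W) b (by
    rw [map_sub, hX01]; linear_combination hdiv)
  obtain ⟨s1, hs1⟩ := pow_expand (X 1) (X 0 ^ (j+1) * a) k
  obtain ⟨s2, hs2⟩ := pow_expand (X 2) (X 0 ^ (j+1) * b) l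
  rw [hs1, hs2] at hw
  have hu : (X 0 : P3) ^ (j+1) ∣ u - 1 := by
    refine X0_prime.pow_dvd_of_dvd_mul_right (j+1) (r_not_dvd k l hl) ?_
    rw [← hrdef]
    refine ⟨a * ((k : P3) * X 1 ^ (k-1)) + b * ((l : P3) * X 2 ^ (l-1)) + X 0 ^ (j+1) * a^2 * s1 +
      X 0 ^ (j+1) * b^2 * s2 - X 0 ^ (e+1) * w, ?_⟩
    linear_combination -hw + hrdef
  obtain ⟨v, hv⟩ := hu
  have hmain : a * ((k : P3) * X 1 ^ (k-1)) + b * ((l : P3) * X 2 ^ (l-1)) = v * r +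
      X 0 * (X 0 ^ e * w - X 0 ^ j * a^2 * s1 - X 0 ^ j * b^2 * s2) := by
    apply mul_left_cancel₀ hX
    linear_combination hw + r * hv - hrdef
  obtain ⟨c', γ, u', hH⟩ := curve k l hk hl hkl H v
    (X 0 ^ e * w - X 0 ^ j * a^2 * s1 - X 0 ^ j * b^2 * s2 -
      antider 1 W * ((k : P3) * X 1 ^ (k-1))) (by
      rw [← hb, ← ha, ← hrdef]
      linear_combination hmain)
  rw [← hrdef] at hH
  have hH1 : pderiv 1 H = pderiv 1 (γ * r) + X 0 * pderiv 1 u' := by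
    rw [hH, map_add, map_add, pderiv_C, pderiv_mul (f := X 0), pderiv_X_of_ne (by decide)]; ring
  have hH2 : pderiv 2 H = pderiv 2 (γ * r) + X 0 * pderiv 2 u' := by
    rw [hH, map_add, map_add, pderiv_C, pderiv_mul (f := X 0), pderiv_X_of_ne (by decide)]; ring
  refine ⟨γ, ⟨antider 1 W - pderiv 2 u', ?_⟩, ⟨pderiv 1 u', ?_⟩⟩
  · linear_combination ha - hH2
  · linear_combination hb + hH1

end AbarAux

namespace AbarAux

open IsNilpotent TensorProduct in
theorem exp_bilin {R B : Type*} [CommRing R] [AddCommGroup B]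
    [Module R B] [Module ℚ B]
    (β : B →ₗ[R] B →ₗ[R] B)
    (D : B →ₗ[R] B) (h_der : ∀ x y, D (β x y) = β x (D y) + β (D x) y)
    (h_nil : IsNilpotent D) (x y : B) :
    exp D (β x y) = β (exp D x) (exp D y) := by
  let DL : Module.End R (B ⊗[R] B) := D.lTensor B
  let DR : Module.End R (B ⊗[R] B) := D.rTensor B
  have h_nilL : IsNilpotent DL := h_nil.map <| Module.End.lTensorAlgHom R B B
  have h_nilR : IsNilpotent DR := h_nil.map <| Module.End.rTensorAlgHom R B B
  have h_comm : Commute DL DR := by ext; simp [DL, DR]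
  set m : B ⊗[R] B →ₗ[R] B := TensorProduct.lift β with hm
  have h₁ : exp D (β x y) = m (exp (DL + DR) (x ⊗ₜ[R] y)) := by
    suffices exp D ∘ₗ m = m ∘ₗ exp (DL + DR) by
      simpa [hm] using! LinearMap.congr_fun this (x ⊗ₜ[R] y)
    apply Module.End.commute_exp_left_of_commute (h_comm.isNilpotent_add h_nilL h_nilR) h_nil
    ext
    simp [DL, DR, hm, h_der]
  have h₂ : exp DL = (exp D).lTensor B :=
    (h_nil.map_exp (Module.End.lTensorAlgHom R B B)).symm
  have h₃ : exp DR = (exp D).rTensor B :=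
    (h_nil.map_exp (Module.End.rTensorAlgHom R B B)).symm
  simp [h₁, exp_add_of_commute h_comm h_nilL h_nilR, h₂, h₃, hm]

lemma qk_surj (d : ℕ) : Function.Surjective (qk d) := Ideal.Quotient.mkₐ_surjective ℂ (Idl d)

lemma qk_eq_zero (d : ℕ) (f : P3) : qk d f = 0 ↔ f ∈ Idl d := Ideal.Quotient.eq_zero_iff_mem

lemma qk_eq (d : ℕ) (f g : P3) : qk d f = qk d g ↔ f - g ∈ Idl d := by
  rw [← qk_eq_zero, map_sub, sub_eq_zero]

lemma pderiv_idl (d : ℕ) (i : Fin 3) (hi : i ≠ 0) (f : P3) (hf : qk d f = 0) :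
    qk d (pderiv i f) = 0 := by
  rw [qk_eq_zero] at *
  obtain ⟨g, rfl⟩ := Ideal.mem_span_singleton.mp hf
  rw [pderiv_mul, pderiv_pow, pderiv_X_of_ne hi.symm]
  exact Ideal.mem_span_singleton.mpr ⟨pderiv i g, by ring⟩

/-- the induced partial derivatives on the quotient -/
noncomputable def dQ (d : ℕ) (i : Fin 3) (hi : i ≠ 0) : Derivation ℂ (Qr d) (Qr d) :=
  Derivation.liftOfSurjective (qk_surj d) (d := pderiv i) (pderiv_idl d i hi)

lemma dQ_qk (d : ℕ) (i : Fin 3) (hi : i ≠ 0) (f : P3) : dQ d i hi (qk d f) = qk d (pderiv i f) :=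
  Derivation.liftOfSurjective_apply (qk_surj d) (pderiv_idl d i hi) f

noncomputable def Dz (d : ℕ) := dQ d 1 (by decide)
noncomputable def Dt (d : ℕ) := dQ d 2 (by decide)

lemma Dz_qk (d : ℕ) (f : P3) : Dz d (qk d f) = qk d (pderiv 1 f) := dQ_qk _ _ _ _
lemma Dt_qk (d : ℕ) (f : P3) : Dt d (qk d f) = qk d (pderiv 2 f) := dQ_qk _ _ _ _

lemma qsmul (d : ℕ) (c : ℂ) (f : Qr d) : c • f = qk d (C c) * f := by
  obtain ⟨f, rfl⟩ := qk_surj d f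
  rw [← map_smul, smul_eq_C_mul, map_mul]

lemma Dz_smul (d : ℕ) (c : ℂ) (f : Qr d) : Dz d (qk d (C c) * f) = qk d (C c) * Dz d f := by
  rw [← qsmul, (Dz d).map_smul, qsmul]
lemma Dt_smul (d : ℕ) (c : ℂ) (f : Qr d) : Dt d (qk d (C c) * f) = qk d (C c) * Dt d f := by
  rw [← qsmul, (Dt d).map_smul, qsmul]

section abstr
variable {A : Type*} [CommRing A] [Algebra ℂ A] (D E : Derivation ℂ A A) (x : A)

lemma abs_br (hDE : ∀ f, D (E f) = E (D f)) (hD : D x = 0) (hE : E x = 0) (h f g : A) :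
    x * (D h * E (D f * E g - E f * D g) - E h * D (D f * E g - E f * D g)) =
    (D f * E (x * (D h * E g - E h * D g)) - E f * D (x * (D h * E g - E h * D g))) +
    (D (x * (D h * E f - E h * D f)) * E g - E (x * (D h * E f - E h * D f)) * D g) := by
  simp only [Derivation.leibniz, smul_eq_mul, map_sub, hD, hE, hDE]
  ring

lemma abs_pow (hD : D x = 0) (n : ℕ) (f : A) : D (x ^ n * f) = x ^ n * D f := by
  simp [Derivation.leibniz, Derivation.leibniz_pow, hD]

lemma abs_del (h f g : A) : x * (D h * E (f * g) - E h * D (f * g)) =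
    f * (x * (D h * E g - E h * D g)) + x * (D h * E f - E h * D f) * g := by
  simp only [Derivation.leibniz, smul_eq_mul]
  ring

lemma abs_dvd (γ r g : A) : r ∣ x * (D (γ * r) * E (r * g) - E (γ * r) * D (r * g)) := by
  simp only [Derivation.leibniz, smul_eq_mul]
  exact ⟨x * (D γ * (r * E g + g * E r) - E γ * (r * D g + g * D r)
      + γ * (D r * E g - E r * D g)), by ring⟩

end abstr

/-- the induced bracket -/
noncomputable def br (d : ℕ) : Qr d →ₗ[ℂ] Qr d →ₗ[ℂ] Qr d :=
  LinearMap.mk₂ ℂ (fun f g => Dz d f * Dt d g - Dt d f * Dz d g)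
    (by intros; simp only [map_add]; ring)
    (by intros; simp only [Dz_smul, Dt_smul, qsmul]; ring)
    (by intros; simp only [map_add]; ring)
    (by intros; simp only [Dz_smul, Dt_smul, qsmul]; ring)

lemma br_apply (d : ℕ) (f g : Qr d) : br d f g = Dz d f * Dt d g - Dt d f * Dz d g := rfl

lemma br_qk (d : ℕ) (f g : P3) : br d (qk d f) (qk d g) = qk d (pb f g) := by
  rw [br_apply, Dz_qk, Dz_qk, Dt_qk, Dt_qk, pb, map_sub, map_mul, map_mul]

lemma Dzt (d : ℕ) (f : Qr d) : Dz d (Dt d f) = Dt d (Dz d f) := by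
  obtain ⟨f, rfl⟩ := qk_surj d f
  rw [Dt_qk, Dz_qk, Dz_qk, Dt_qk, pderiv_comm']

noncomputable def xx (d : ℕ) : Qr d := qk d (X 0)

lemma Dz_xx (d : ℕ) : Dz d (xx d) = 0 := by
  rw [xx, Dz_qk, pderiv_X_of_ne (by decide), map_zero]
lemma Dt_xx (d : ℕ) : Dt d (xx d) = 0 := by
  rw [xx, Dt_qk, pderiv_X_of_ne (by decide), map_zero]

lemma xx_pow (d : ℕ) : xx d ^ d = 0 := by
  rw [xx, ← map_pow, qk_eq_zero]
  exact Ideal.subset_span rfl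

/-- the derivation `x * {h, -}` -/
noncomputable def del (d : ℕ) (h : Qr d) : Module.End ℂ (Qr d) :=
  LinearMap.mulLeft ℂ (xx d) ∘ₗ br d h

lemma del_apply (d : ℕ) (h f : Qr d) : del d h f = xx d * br d h f := rfl

lemma del_mul (d : ℕ) (h f g : Qr d) : del d h (f * g) = f * del d h g + del d h f * g := abs_del (Dz d) (Dt d) (xx d) h f g

lemma del_br (d : ℕ) (h f g : Qr d) :
    del d h (br d f g) = br d f (del d h g) + br d (del d h f) g := abs_br (Dz d) (Dt d) (xx d) (Dzt d) (Dz_xx d) (Dt_xx d) h f g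

lemma del_xx (d : ℕ) (h : Qr d) : del d h (xx d) = 0 := by
  simp [del_apply, br_apply, Dz_xx, Dt_xx]

lemma del_neg (d : ℕ) (h : Qr d) : del d (-h) = - del d h := by
  apply LinearMap.ext; intro f
  rw [LinearMap.neg_apply, del_apply, del_apply, map_neg, LinearMap.neg_apply]
  ring

lemma br_xmul (d n : ℕ) (h f : Qr d) : br d h (xx d ^ n * f) = xx d ^ n * br d h f := by
  rw [br_apply, br_apply, abs_pow _ _ (Dz_xx d), abs_pow _ _ (Dt_xx d)]
  ring

lemma br_xmul_left (d n : ℕ) (h f : Qr d) : br d (xx d ^ n * h) f = xx d ^ n * br d h f := by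
  rw [br_apply, br_apply, abs_pow _ _ (Dz_xx d), abs_pow _ _ (Dt_xx d)]
  ring

/-- if `h = x^j h'` then `del^n f` is divisible by `x^((j+1) n)` -/
lemma del_pow (d j n : ℕ) (h f : Qr d) :
    xx d ^ ((j + 1) * n) ∣ (del d (xx d ^ j * h) ^ n) f := by
  induction n with
  | zero => simp
  | succ n ih =>
    obtain ⟨g, hg⟩ := ih
    rw [pow_succ', Module.End.mul_apply, hg, del_apply, br_xmul, br_xmul_left]
    exact ⟨br d h g, by ring⟩

lemma del_nil (d : ℕ) (h : Qr d) : del d h ^ d = 0 := by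
  apply LinearMap.ext; intro f
  have := del_pow d 0 d h f
  simp only [pow_zero, one_mul, zero_add, xx_pow] at this
  exact zero_dvd_iff.mp this

lemma del_isNil (d : ℕ) (h : Qr d) : IsNilpotent (del d h) := ⟨d, del_nil d h⟩

noncomputable def ex (d : ℕ) (h : Qr d) : Module.End ℂ (Qr d) := IsNilpotent.exp (del d h)

lemma ex_apply (d : ℕ) (h f : Qr d) :
    ex d h f = ∑ n ∈ Finset.range d, ((n.factorial : ℂ)⁻¹) • (del d h ^ n) f := by
  rw [ex, IsNilpotent.exp_eq_sum (del_nil d h), LinearMap.sum_apply]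
  refine Finset.sum_congr rfl fun n _ => ?_
  rw [LinearMap.smul_apply, ← Rat.cast_smul_eq_qsmul ℂ]
  simp

lemma ex_mul (d : ℕ) (h f g : Qr d) : ex d h (f * g) = ex d h f * ex d h g :=
  Module.End.exp_mul_of_derivation ℂ (Qr d) (del d h) (del_mul d h) (del_isNil d h) f g

lemma ex_br (d : ℕ) (h f g : Qr d) : ex d h (br d f g) = br d (ex d h f) (ex d h g) :=
  exp_bilin (br d) (del d h) (del_br d h) (del_isNil d h) f g

lemma ex_of_del (d : ℕ) (hd : 1 ≤ d) (h f : Qr d) (hf : del d h f = 0) : ex d h f = f := by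
  rw [ex_apply, Finset.sum_eq_single_of_mem 0 (by simpa using (by omega : 0 < d))]
  · simp
  · intro n _ hn
    obtain ⟨m, rfl⟩ := Nat.exists_eq_succ_of_ne_zero hn
    rw [Nat.succ_eq_add_one, pow_succ, Module.End.mul_apply, hf, map_zero, smul_zero]

lemma ex_one (d : ℕ) (hd : 1 ≤ d) (h : Qr d) : ex d h 1 = 1 :=
  ex_of_del d hd h 1 (by simp [del_apply, br_apply])

lemma ex_inv (d : ℕ) (h f : Qr d) : ex d h (ex d (-h) f) = f := by
  have := IsNilpotent.exp_mul_exp_neg_self (del_isNil d h)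
  rw [← del_neg] at this
  exact LinearMap.congr_fun this f

noncomputable def exHom (d : ℕ) (hd : 1 ≤ d) (h : Qr d) : Qr d →ₐ[ℂ] Qr d :=
  AlgHom.ofLinearMap (ex d h) (ex_one d hd h) (ex_mul d h)

noncomputable def exA (d : ℕ) (hd : 1 ≤ d) (h : Qr d) : Qr d ≃ₐ[ℂ] Qr d :=
  AlgEquiv.ofAlgHom (exHom d hd h) (exHom d hd (-h))
    (by apply AlgHom.ext; intro f; exact ex_inv d h f)
    (by
      apply AlgHom.ext; intro f
      have := ex_inv d (-h) f
      rw [neg_neg] at this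
      exact this)

lemma exA_apply (d : ℕ) (hd : 1 ≤ d) (h f : Qr d) : exA d hd h f = ex d h f := rfl

lemma exA_mul (d : ℕ) (hd : 1 ≤ d) (h : Qr d) : exA d hd h * exA d hd (-h) = 1 := by
  apply AlgEquiv.ext; intro f
  exact ex_inv d h f

lemma qk_iter (d : ℕ) (H f : P3) (n : ℕ) :
    qk d ((fun g => X 0 * pb H g)^[n] f) = (del d (qk d H) ^ n) (qk d f) := by
  induction n with
  | zero => simp
  | succ n ih =>
    rw [Function.iterate_succ_apply', map_mul, ← br_qk, ih, pow_succ', Module.End.mul_apply]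
    rfl

lemma mem_gens (d : ℕ) (hd : 1 ≤ d) (r : P3) (φ : Qr d ≃ₐ[ℂ] Qr d) :
    φ ∈ ExpGensR d r ↔ ∃ γ : Qr d, φ = exA d hd (γ * qk d r) := by
  have key : ∀ γ f : P3, qk d (∑ n ∈ Finset.range d,
          ((n.factorial : ℂ)⁻¹) • (fun g => X 0 * pb (γ * r) g)^[n] f) =
          exA d hd (qk d γ * qk d r) (qk d f) := by
    intro γ f
    rw [exA_apply, ex_apply, map_sum]
    refine Finset.sum_congr rfl fun n _ => ?_
    rw [map_smul, qk_iter, map_mul]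
  constructor
  · rintro ⟨γ, h⟩
    refine ⟨qk d γ, ?_⟩
    apply AlgEquiv.ext; intro f
    obtain ⟨f, rfl⟩ := qk_surj d f
    rw [h f, key]
  · rintro ⟨γ, rfl⟩
    obtain ⟨γ, rfl⟩ := qk_surj d γ
    exact ⟨γ, fun f => (key γ f).symm⟩

lemma gens_inv (d : ℕ) (hd : 1 ≤ d) (r : P3) (φ : Qr d ≃ₐ[ℂ] Qr d)
    (h : φ ∈ ExpGensR d r) : φ⁻¹ ∈ ExpGensR d r := by
  rw [mem_gens d hd] at *
  obtain ⟨γ, rfl⟩ := h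
  refine ⟨-γ, ?_⟩
  have hn : -γ * qk d r = -(γ * qk d r) := by ring
  rw [hn]
  exact inv_eq_of_mul_eq_one_right (exA_mul d hd _)

/-- Invariant description of membership. -/
def Good (d : ℕ) (r : P3) (φ : Qr d ≃ₐ[ℂ] Qr d) : Prop :=
  φ (xx d) = xx d ∧
  (∃ c : ℂ, c ≠ 0 ∧ br d (φ (qk d (X 1))) (φ (qk d (X 2))) = algebraMap ℂ (Qr d) c) ∧
  xx d ∣ φ (qk d (X 1)) - qk d (X 1) ∧ xx d ∣ φ (qk d (X 2)) - qk d (X 2) ∧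
  qk d r ∣ φ (qk d r)

lemma dvd_qk (d j : ℕ) (hj : j ≤ d) (f : P3) :
    f ∈ Ideal.span {(X 0 : P3) ^ j} ↔ xx d ^ j ∣ qk d f := by
  rw [Ideal.mem_span_singleton]
  constructor
  · rintro ⟨g, rfl⟩
    exact ⟨qk d g, by simp [xx]⟩
  · rintro ⟨g, hg⟩
    obtain ⟨g, rfl⟩ := qk_surj d g
    rw [xx, ← map_pow, ← map_mul, qk_eq] at hg
    have h2 : (X 0 : P3) ^ j ∣ f - X 0 ^ j * g :=
      (pow_dvd_pow _ hj).trans (Ideal.mem_span_singleton.mp hg)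
    exact (dvd_sub_left (dvd_mul_right _ _)).mp h2

lemma qk_C (d : ℕ) (c : ℂ) : qk d (C c) = algebraMap ℂ (Qr d) c := rfl

lemma memAr_iff (d : ℕ) (hd : 1 ≤ d) (r : P3) (φ : Qr d ≃ₐ[ℂ] Qr d) :
    MemAr d 1 r φ ↔ Good d r φ := by
  constructor
  · rintro ⟨⟨h0, p, q, hp, hq, ⟨c, hc, hpq⟩, h1, h2⟩, hr⟩
    refine ⟨h0, ⟨c, hc, ?_⟩, ?_, ?_, Ideal.mem_span_singleton.mp hr⟩
    · rw [hp, hq, br_qk, ← qk_C, qk_eq]; exact hpq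
    · rw [dvd_qk d 1 hd, pow_one] at h1
      rw [hp, ← map_sub]; exact h1
    · rw [dvd_qk d 1 hd, pow_one] at h2
      rw [hq, ← map_sub]; exact h2
  · rintro ⟨h0, ⟨c, hc, hJ⟩, h1, h2, hr⟩
    obtain ⟨p, hp⟩ := qk_surj d (φ (qk d (X 1)))
    obtain ⟨q, hq⟩ := qk_surj d (φ (qk d (X 2)))
    rw [← hp, ← hq, br_qk, ← qk_C, qk_eq] at hJ
    refine ⟨⟨h0, p, q, hp.symm, hq.symm, ⟨c, hc, hJ⟩, ?_, ?_⟩, Ideal.mem_span_singleton.mpr hr⟩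
    · rw [dvd_qk d 1 hd, pow_one, map_sub, hp]; exact h1
    · rw [dvd_qk d 1 hd, pow_one, map_sub, hq]; exact h2

lemma chain (d : ℕ) (D : Derivation ℂ (Qr d) (Qr d)) (hD : D (xx d) = 0)
    (φ : Qr d ≃ₐ[ℂ] Qr d) (hφ : φ (xx d) = xx d) (f : Qr d) :
    D (φ f) = φ (Dz d f) * D (φ (qk d (X 1))) + φ (Dt d f) * D (φ (qk d (X 2))) := by
  obtain ⟨f, rfl⟩ := qk_surj d f
  induction f using MvPolynomial.induction_on with
  | C a =>
    rw [qk_C, AlgEquiv.commutes, Derivation.map_algebraMap, Derivation.map_algebraMap,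
      Derivation.map_algebraMap]
    simp
  | add p q hp hq => simp only [map_add, hp, hq]; ring
  | mul_X p i hp =>
    rw [map_mul, map_mul, Derivation.leibniz, Derivation.leibniz, Derivation.leibniz, hp]
    simp only [smul_eq_mul, map_add, map_mul]
    fin_cases i
    · change φ (qk d p) * D (φ (xx d)) + φ (xx d) * _ = (_ * φ (Dz d (xx d)) + φ (xx d) * _) * _ +
        (_ * φ (Dt d (xx d)) + φ (xx d) * _) * _
      rw [hφ, hD, Dz_xx, Dt_xx]
      simp only [map_zero]
      ring
    · simp only [Fin.mk_one, Dz_qk, Dt_qk, pderiv_X_self,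
        pderiv_X_of_ne (show (1 : Fin 3) ≠ 2 by decide), map_one, map_zero]
      ring
    · simp only [Fin.reduceFinMk, Dz_qk, Dt_qk, pderiv_X_self,
        pderiv_X_of_ne (show (2 : Fin 3) ≠ 1 by decide), map_one, map_zero]
      ring

lemma br_map (d : ℕ) (φ : Qr d ≃ₐ[ℂ] Qr d) (hφ : φ (xx d) = xx d) (f g : Qr d) :
    br d (φ f) (φ g) = br d (φ (qk d (X 1))) (φ (qk d (X 2))) * φ (br d f g) := by
  rw [br_apply, br_apply, br_apply, chain d _ (Dz_xx d) φ hφ f, chain d _ (Dz_xx d) φ hφ g,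
    chain d _ (Dt_xx d) φ hφ f, chain d _ (Dt_xx d) φ hφ g, map_sub, map_mul, map_mul]
  ring

lemma dvd_mul_step (d j : ℕ) (φ ψ : Qr d ≃ₐ[ℂ] Qr d) (hφ : φ (xx d) = xx d) (f : Qr d)
    (h1 : xx d ^ j ∣ φ f - f) (h2 : xx d ^ j ∣ ψ f - f) : xx d ^ j ∣ φ (ψ f) - f := by
  have h3 : xx d ^ j ∣ φ (ψ f - f) := by
    have := map_dvd φ h2
    rwa [map_pow, hφ] at this
  rw [map_sub] at h3
  have := dvd_add h3 h1
  simpa using this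

lemma Good.mul (d : ℕ) (r : P3) (φ ψ : Qr d ≃ₐ[ℂ] Qr d) (h1 : Good d r φ) (h2 : Good d r ψ) :
    Good d r (φ * ψ) := by
  obtain ⟨a0, ⟨c, hc, hJ⟩, a1, a2, a3⟩ := h1
  obtain ⟨b0, ⟨c', hc', hJ'⟩, b1, b2, b3⟩ := h2
  simp only [Good, AlgEquiv.mul_apply]
  refine ⟨by rw [b0, a0], ⟨c * c', mul_ne_zero hc hc', ?_⟩, ?_, ?_, ?_⟩
  · rw [br_map d φ a0, hJ, hJ', AlgEquiv.commutes, map_mul]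
  · simpa using dvd_mul_step d 1 φ ψ a0 _ (by simpa using a1) (by simpa using b1)
  · simpa using dvd_mul_step d 1 φ ψ a0 _ (by simpa using a2) (by simpa using b2)
  · exact a3.trans (map_dvd φ b3)

lemma Good.one (d : ℕ) (r : P3) : Good d r 1 := by
  refine ⟨rfl, ⟨1, one_ne_zero, ?_⟩, ?_, ?_, ?_⟩
  · simp only [AlgEquiv.one_apply]
    rw [br_qk, pb, pderiv_X_self, pderiv_X_self, pderiv_X_of_ne (by decide)]
    simp
  · simp
  · simp
  · simp

/-- first order expansion -/
lemma ex_expand (d j : ℕ) (hd : 2 ≤ d) (h f : Qr d) :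
    xx d ^ (j + 2) ∣ ex d (xx d ^ j * h) f - f - xx d ^ (j + 1) * br d h f := by
  obtain ⟨d, rfl⟩ := Nat.exists_eq_add_of_le' hd
  rw [ex_apply, Finset.sum_range_succ', Finset.sum_range_succ']
  simp only [zero_add, pow_zero, pow_one, Nat.factorial_zero, Nat.factorial_one, Nat.cast_one,
    inv_one, one_smul, Module.End.one_apply]
  rw [del_apply, br_xmul_left]
  have : xx (d+2) ^ (j+2) ∣ ∑ n ∈ Finset.range d, (((n + 1 + 1).factorial : ℂ)⁻¹) •
      (del (d+2) (xx (d+2) ^ j * h) ^ (n + 1 + 1)) f := by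
    refine Finset.dvd_sum fun n _ => ?_
    have h1 := del_pow (d+2) j (n+1+1) h f
    have h2 : xx (d+2) ^ (j+2) ∣ xx (d+2) ^ ((j+1) * (n+1+1)) :=
      pow_dvd_pow _ (by nlinarith [Nat.zero_le (j * n)])
    rw [qsmul]
    exact (h2.trans h1).mul_left _
  convert this using 1
  ring

lemma del_dvd (d : ℕ) (γ r f : Qr d) (n : ℕ) (hf : r ∣ f) : r ∣ (del d (γ * r) ^ n) f := by
  induction n with
  | zero => simpa using hf
  | succ n ih =>
    rw [pow_succ', Module.End.mul_apply]
    obtain ⟨g, hg⟩ := ih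
    rw [hg, del_apply, br_apply]
    exact abs_dvd (Dz d) (Dt d) (xx d) γ r g

lemma Good.gen (d : ℕ) (hd : 2 ≤ d) (r : P3) (γ : Qr d) :
    Good d r (exA d (by omega) (γ * qk d r)) := by
  have hx : ∀ f, xx d ∣ ex d (γ * qk d r) f - f := by
    intro f
    have h := ex_expand d 0 hd (γ * qk d r) f
    rw [pow_zero, one_mul, zero_add, zero_add] at h
    have h1 : xx d ∣ xx d ^ 2 := dvd_pow_self _ (by norm_num)
    have h2 : xx d ∣ xx d ^ 1 * br d (γ * qk d r) f := by
      rw [pow_one]; exact dvd_mul_right _ _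
    exact (dvd_sub_left h2).mp (h1.trans h)
  refine ⟨ex_of_del d (by omega) _ _ (del_xx d _), ⟨1, one_ne_zero, ?_⟩, hx _, hx _, ?_⟩
  · rw [exA_apply, exA_apply, ← ex_br, br_qk, pb, pderiv_X_self, pderiv_X_self,
      pderiv_X_of_ne (by decide), map_one]
    simp [ex_one d (show 1 ≤ d by omega)]
  · rw [exA_apply, ex_apply]
    refine Finset.dvd_sum fun n _ => ?_
    rw [qsmul]
    exact (del_dvd d γ _ _ n dvd_rfl).mul_left _

lemma closure_good (d : ℕ) (hd : 2 ≤ d) (r : P3) (φ : Qr d ≃ₐ[ℂ] Qr d)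
    (h : φ ∈ Subgroup.closure (ExpGensR d r)) : Good d r φ := by
  have gen : ∀ φ ∈ ExpGensR d r, Good d r φ := by
    intro φ h
    obtain ⟨γ, rfl⟩ := (mem_gens d (by omega) r φ).mp h
    exact Good.gen d hd r γ
  rw [← Subgroup.mem_toSubmonoid, Subgroup.closure_toSubmonoid] at h
  induction h using Submonoid.closure_induction with
  | mem φ h =>
    rcases h with h | h
    · exact gen φ h
    · have := gens_inv d (by omega) r _ h
      rw [inv_inv] at this
      exact gen φ this
  | one => exact Good.one d r
  | mul φ ψ _ _ h1 h2 => exact Good.mul d r φ ψ h1 h2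

lemma eq_one (d : ℕ) (φ : Qr d ≃ₐ[ℂ] Qr d) (h0 : φ (xx d) = xx d)
    (h1 : φ (qk d (X 1)) = qk d (X 1)) (h2 : φ (qk d (X 2)) = qk d (X 2)) : φ = 1 := by
  have : (φ : Qr d →ₐ[ℂ] Qr d).comp (qk d) = qk d := by
    apply MvPolynomial.algHom_ext
    intro i
    fin_cases i
    · exact h0
    · exact h1
    · exact h2
  apply AlgEquiv.ext; intro f
  obtain ⟨f, rfl⟩ := qk_surj d f
  exact congrArg (fun g => g f) this

lemma step (d k l j : ℕ) (hd : 2 ≤ d) (hk : 2 ≤ k) (hl : 2 ≤ l)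
    (hkl : Nat.Coprime k l) (hjd : j + 1 < d) (φ : Qr d ≃ₐ[ℂ] Qr d)
    (hφ : Good d (X 1 ^ k + X 2 ^ l + X 0) φ)
    (h1 : xx d ^ (j + 1) ∣ φ (qk d (X 1)) - qk d (X 1))
    (h2 : xx d ^ (j + 1) ∣ φ (qk d (X 2)) - qk d (X 2)) :
    ∃ ε ∈ ExpGensR d (X 1 ^ k + X 2 ^ l + X 0),
      xx d ^ (j + 2) ∣ φ (qk d (X 1)) - ε (qk d (X 1)) ∧
      xx d ^ (j + 2) ∣ φ (qk d (X 2)) - ε (qk d (X 2)) := by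
  obtain ⟨h0, ⟨c, hc, hJ⟩, -, -, u, hu⟩ := hφ
  obtain ⟨a, ha⟩ := h1
  obtain ⟨b, hb⟩ := h2
  obtain ⟨a, rfl⟩ := qk_surj d a
  obtain ⟨b, rfl⟩ := qk_surj d b
  obtain ⟨u, rfl⟩ := qk_surj d u
  have ha' : φ (qk d (X 1)) = qk d (X 1 + X 0 ^ (j+1) * a) := by
    rw [map_add, map_mul, map_pow]
    exact (sub_eq_iff_eq_add'.mp ha)
  have hb' : φ (qk d (X 2)) = qk d (X 2 + X 0 ^ (j+1) * b) := by
    rw [map_add, map_mul, map_pow]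
    exact (sub_eq_iff_eq_add'.mp hb)
  have h0' : φ (qk d (X 0)) = qk d (X 0) := h0
  obtain ⟨γ, ⟨a', hγ1⟩, ⟨b', hγ2⟩⟩ := key d k l (j+1) (by omega) hjd hk hl hkl a b u c (by
      rw [← qk_eq, ← br_qk, ← ha', ← hb', hJ, qk_C]) (by
      rw [← qk_eq, mul_comm u, map_mul (qk d) _ u, ← hu]
      simp only [map_add (qk d) _ (X 0), map_add (qk d) (_ ^ _) (_ ^ _), map_pow (qk d), ← ha', ← hb',
        map_add φ, map_pow φ, h0'])
  set r : P3 := X 1 ^ k + X 2 ^ l + X 0 with hr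
  refine ⟨exA d (by omega) ((xx d ^ j * qk d γ) * qk d r),
    (mem_gens d (by omega) r _).mpr ⟨_, rfl⟩, ?_, ?_⟩
  · rw [exA_apply, mul_assoc]
    obtain ⟨y, hy⟩ := ex_expand d j hd (qk d γ * qk d r) (qk d (X 1))
    rw [← map_mul, br_qk, pb, pderiv_X_self, pderiv_X_of_ne (by decide)] at hy
    refine ⟨qk d a' - y, ?_⟩
    have hg := congrArg (qk d) hγ1
    rw [map_add, map_mul (qk d)] at hg
    simp only [mul_zero, mul_one, zero_sub, map_neg] at hy
    rw [← map_mul]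
    change _ = xx d * _ at hg
    linear_combination ha - hy + xx d ^ (j+1) * hg
  · rw [exA_apply, mul_assoc]
    obtain ⟨y, hy⟩ := ex_expand d j hd (qk d γ * qk d r) (qk d (X 2))
    rw [← map_mul, br_qk, pb, pderiv_X_self, pderiv_X_of_ne (by decide)] at hy
    refine ⟨qk d b' - y, ?_⟩
    have hg := congrArg (qk d) hγ2
    rw [map_sub, map_mul (qk d)] at hg
    simp only [mul_zero, mul_one, sub_zero] at hy
    rw [← map_mul]
    change _ = xx d * _ at hg
    linear_combination hb - hy + xx d ^ (j+1) * hg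

lemma good_closure (d k l : ℕ) (hd : 2 ≤ d) (hk : 2 ≤ k) (hl : 2 ≤ l)
    (hkl : Nat.Coprime k l) (m : ℕ) : ∀ (j : ℕ), j + 1 + m = d → ∀ (φ : Qr d ≃ₐ[ℂ] Qr d),
    Good d (X 1 ^ k + X 2 ^ l + X 0) φ →
    xx d ^ (j + 1) ∣ φ (qk d (X 1)) - qk d (X 1) →
    xx d ^ (j + 1) ∣ φ (qk d (X 2)) - qk d (X 2) →
    φ ∈ Subgroup.closure (ExpGensR d (X 1 ^ k + X 2 ^ l + X 0)) := by
  induction m with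
  | zero =>
    intro j hj φ hφ h1 h2
    rw [add_zero] at hj
    rw [hj, xx_pow, zero_dvd_iff, sub_eq_zero] at h1 h2
    rw [eq_one d φ hφ.1 h1 h2]
    exact one_mem _
  | succ m ih =>
    intro j hj φ hφ h1 h2
    obtain ⟨ε, hε, e1, e2⟩ := step d k l j hd hk hl hkl (by omega) φ hφ h1 h2
    have hε' := gens_inv d (by omega) _ _ hε
    have hin := Subgroup.subset_closure hε'
    have hg := closure_good d hd _ _ hin
    have hdv : ∀ f : Qr d, xx d ^ (j+2) ∣ φ f - ε f → xx d ^ (j+2) ∣ (ε⁻¹ * φ) f - f := by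
      intro f hf
      have := map_dvd (ε⁻¹) hf
      rw [map_pow, hg.1, map_sub] at this
      have h3 : ε⁻¹ (ε f) = f := ε.symm_apply_apply f
      rwa [h3] at this
    have := ih (j+1) (by omega) (ε⁻¹ * φ) (Good.mul d _ _ _ hg hφ) (hdv _ e1) (hdv _ e2)
    have h4 := mul_mem (Subgroup.subset_closure hε) this
    rwa [mul_inv_cancel_left] at h4

end AbarAux


/-- For `r = z^k + t^l + x` with `k,l ≥ 2` coprime, the group `Ā_1(r)` of
special automorphisms of `R̄[z,t]` congruent to the identity mod `(x)` and
preserving the ideal `(r)` is generated by the exponentials `exp(x·D_{γr})`,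
`γ ∈ R̄[z,t]`. -/
theorem Abar_one_r_generated (d k l : ℕ) (hd : 2 ≤ d) (hk : 2 ≤ k) (hl : 2 ≤ l)
    (hkl : Nat.Coprime k l) :
    let r : MvPolynomial (Fin 3) ℂ := X 1 ^ k + X 2 ^ l + X 0
    {φ : Qr d ≃ₐ[ℂ] Qr d | MemAr d 1 r φ} =
      ↑(Subgroup.closure (ExpGensR d r)) := by
  intro r
  ext φ
  rw [Set.mem_ofPred_eq, AbarAux.memAr_iff d (by omega), SetLike.mem_coe]
  constructor
  · intro h
    exact AbarAux.good_closure d k l hd hk hl hkl (d - 1) 0 (by omega) φ h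
      (by simpa using h.2.2.1) (by simpa using h.2.2.2.1)
  · exact AbarAux.closure_good d hd r φ
end
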